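/- arXiv:2212.07748 — 2 statements merged into one kernel-verified Lean document; each statement's English description precedes it below -/
import Mathlib

section
/- Let G be a finite group of order n and suppose the largest prime divisor of n is a prime p with p > 7. If there exists a positive integer k ≥ 4 such that ψ_k(G) > ((1 + 15·2^k + 20·3^k + 24·5^k) / ((1 + 2^k + 2·4^k)(1 + 2·3^k)(1 + 4·5^k))) · ψ_k(ℤ_n), then G is solvable. -/
/-- `psi G k` is the sum of the `k`-th powers of the orders of the elements of `G`. -/
noncomputable def psi (G : Type*) [Group G] [Fintype G] (k : ℕ) : ℕ :=
  ∑ g : G, orderOf g ^ k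

/-- The sum of the `k`-th powers of the element orders of the cyclic group of order `n`. -/
def cyclicPsi (k n : ℕ) : ℕ := ∑ d ∈ n.divisors, d.totient * d ^ k

theorem cyclicPsi_one (k : ℕ) : cyclicPsi k 1 = 1 := by simp [cyclicPsi]

theorem cyclicPsi_pos (k : ℕ) {n : ℕ} (hn : n ≠ 0) : 0 < cyclicPsi k n := by
  refine Finset.sum_pos' (fun _ _ => Nat.zero_le _) ⟨1, by simp [hn], by simp⟩

theorem totient_mul_pow_le_cyclicPsi (k : ℕ) {n : ℕ} (hn : n ≠ 0) :
    n.totient * n ^ k ≤ cyclicPsi k n :=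
  Finset.single_le_sum (f := fun d => d.totient * d ^ k) (fun _ _ => Nat.zero_le _)
    (Nat.mem_divisors_self n hn)

open ArithmeticFunction in
theorem cyclicPsi_mul_of_coprime (k : ℕ) {m n : ℕ} (h : m.Coprime n) :
    cyclicPsi k (m * n) = cyclicPsi k m * cyclicPsi k n := by
  let f : ArithmeticFunction ℕ := ⟨fun d => d.totient * d ^ k, by simp⟩
  have hf : f.IsMultiplicative := by
    refine ⟨by simp [f], fun {a b} hab => ?_⟩
    change (a * b).totient * (a * b) ^ k = a.totient * a ^ k * (b.totient * b ^ k)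
    rw [Nat.totient_mul hab]
    ring
  have key (n : ℕ) : cyclicPsi k n = (f * (zeta : ArithmeticFunction ℕ)) n :=
    (coe_mul_zeta_apply (f := f) (x := n)).symm
  simp only [key]
  have hz : (zeta : ArithmeticFunction ℕ).IsMultiplicative := isMultiplicative_zeta.natCast
  exact (hf.mul hz).map_mul_of_coprime h

theorem cyclicPsi_prime_pow_succ (k : ℕ) {q : ℕ} (hq : q.Prime) (a : ℕ) :
    cyclicPsi k (q ^ (a + 1)) + q ^ k = q ^ (k + 1) * cyclicPsi k (q ^ a) + 1 := by
  have hsum (b : ℕ) : cyclicPsi k (q ^ b) =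
      ∑ i ∈ Finset.range (b + 1), (q ^ i).totient * (q ^ i) ^ k := Nat.sum_divisors_prime_pow hq
  obtain ⟨r, hr⟩ : ∃ r, q = r + 1 := ⟨q - 1, by have := hq.pos; omega⟩
  have step (b : ℕ) : cyclicPsi k (q ^ (b + 1)) =
      cyclicPsi k (q ^ b) + q ^ b * r * (q ^ (b + 1)) ^ k := by
    rw [hsum, Finset.sum_range_succ, ← hsum b, Nat.totient_prime_pow_succ hq, hr,
      Nat.add_sub_cancel]
  induction a with
  | zero =>
    rw [step]
    simp only [pow_zero, cyclicPsi_one, zero_add, one_mul, mul_one, pow_succ]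
    rw [hr]
    ring
  | succ a ih =>
    calc _ = (cyclicPsi k (q ^ (a + 1)) + q ^ k) + q ^ (a + 1) * r * (q ^ (a + 1 + 1)) ^ k := by
          rw [step (a + 1)]; ring
      _ = _ := by rw [ih, step a]; ring

theorem cyclicPsi_mono_of_dvd (k : ℕ) {m n : ℕ} (hn : n ≠ 0) (h : m ∣ n) :
    cyclicPsi k m ≤ cyclicPsi k n :=
  Finset.sum_le_sum_of_subset (Nat.divisors_subset_of_dvd hn h)

/-- The ratios `cyclicPsi k (q ^ (a + 1)) / cyclicPsi k (q ^ a)` increase with `a`. -/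
theorem cyclicPsi_prime_pow_log_convex (k : ℕ) {q : ℕ} (hq : q.Prime) {a b : ℕ} (hba : b ≤ a) :
    cyclicPsi k (q ^ a) * cyclicPsi k (q ^ (b + 1)) ≤
      cyclicPsi k (q ^ (a + 1)) * cyclicPsi k (q ^ b) := by
  have ha := cyclicPsi_prime_pow_succ k hq a
  have hb := cyclicPsi_prime_pow_succ k hq b
  have hle := cyclicPsi_mono_of_dvd k (pow_ne_zero a hq.ne_zero) (pow_dvd_pow q hba)
  have hqk : 1 ≤ q ^ k := Nat.one_le_pow _ _ hq.pos
  zify at *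
  nlinarith [mul_nonneg (sub_nonneg.2 hle) (sub_nonneg.2 hqk)]

theorem cyclicPsi_log_convex (k : ℕ) {q n b : ℕ} (hq : q.Prime) (hn : n ≠ 0) (h : q ^ b ∣ n) :
    cyclicPsi k n * cyclicPsi k (q ^ (b + 1)) ≤ cyclicPsi k (q * n) * cyclicPsi k (q ^ b) := by
  obtain ⟨a, r, hr, rfl⟩ := Nat.exists_eq_pow_mul_and_not_dvd hn q hq.ne_one
  have hcop (c : ℕ) : (q ^ c).Coprime r := ((Nat.Prime.coprime_iff_not_dvd hq).2 hr).pow_left c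
  have hba : b ≤ a :=
    (Nat.pow_dvd_pow_iff_le_right hq.one_lt).1 ((hcop b).dvd_of_dvd_mul_right h)
  rw [← mul_assoc, ← pow_succ', cyclicPsi_mul_of_coprime k (hcop _),
    cyclicPsi_mul_of_coprime k (hcop _)]
  have := Nat.mul_le_mul_right (cyclicPsi k r) (cyclicPsi_prime_pow_log_convex k hq hba)
  linarith

/-- The ratio `cyclicPsi k (q * n) / cyclicPsi k n` depends only on the `q`-part of `n`. -/
theorem cyclicPsi_ratio (k : ℕ) {q n u : ℕ} (hq : q.Prime) (hn : n ≠ 0)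
    (hqu : q.Coprime u) :
    cyclicPsi k (q * (u * n)) * cyclicPsi k n = cyclicPsi k (q * n) * cyclicPsi k (u * n) := by
  obtain ⟨a, r, hr, rfl⟩ := Nat.exists_eq_pow_mul_and_not_dvd hn q hq.ne_one
  have hcr : q.Coprime r := (Nat.Prime.coprime_iff_not_dvd hq).2 hr
  have hcop (c : ℕ) : (q ^ c).Coprime r := hcr.pow_left c
  have hcop' (c : ℕ) : (q ^ c).Coprime (u * r) := (hqu.mul_right hcr).pow_left c
  have e1 : u * (q ^ a * r) = q ^ a * (u * r) := by ring
  have e2 : q * (q ^ a * (u * r)) = q ^ (a + 1) * (u * r) := by ring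
  have e3 : q * (q ^ a * r) = q ^ (a + 1) * r := by ring
  rw [e1, e2, e3, cyclicPsi_mul_of_coprime k (hcop _), cyclicPsi_mul_of_coprime k (hcop _),
    cyclicPsi_mul_of_coprime k (hcop' _), cyclicPsi_mul_of_coprime k (hcop' _)]
  ring

theorem cyclicPsi_mul_prime_pow_le (k : ℕ) {q n : ℕ} (hq : q.Prime) (hn : n ≠ 0) (e : ℕ) :
    cyclicPsi k n * cyclicPsi k (q ^ e) ≤ cyclicPsi k (n * q ^ e) := by
  induction e with
  | zero => simp [cyclicPsi_one]
  | succ e ih =>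
    have h := cyclicPsi_log_convex k hq (n := n * q ^ e) (b := e)
      (mul_ne_zero hn (pow_ne_zero _ hq.ne_zero)) (Dvd.intro_left _ rfl)
    have e1 : q * (n * q ^ e) = n * q ^ (e + 1) := by ring
    rw [e1] at h
    have hpos := cyclicPsi_pos k (pow_ne_zero e hq.ne_zero)
    refine Nat.le_of_mul_le_mul_right ?_ hpos
    nlinarith [Nat.mul_le_mul_right (cyclicPsi k (q ^ (e + 1))) ih]

theorem cyclicPsi_mul_le (k : ℕ) {m n : ℕ} (hm : m ≠ 0) (hn : n ≠ 0) :
    cyclicPsi k m * cyclicPsi k n ≤ cyclicPsi k (m * n) := by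
  induction n using Nat.recOnPosPrimePosCoprime generalizing m with
  | prime_pow q e hq he => exact cyclicPsi_mul_prime_pow_le k hq hm e
  | zero => exact absurd rfl hn
  | one => simp [cyclicPsi_one]
  | coprime a b ha hb hab iha ihb =>
    rw [cyclicPsi_mul_of_coprime k hab, ← mul_assoc, ← mul_assoc]
    exact (Nat.mul_le_mul_right _ (iha hm (by omega))).trans
      (ihb (mul_ne_zero hm (by omega)) (by omega))

theorem prod_cyclicPsi_le (k : ℕ) {ι : Type*} (s : Finset ι) (f : ι → ℕ) (hf : ∀ i ∈ s, f i ≠ 0) :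
    ∏ i ∈ s, cyclicPsi k (f i) ≤ cyclicPsi k (∏ i ∈ s, f i) := by
  classical
  induction s using Finset.induction_on with
  | empty => simp [cyclicPsi_one]
  | insert a s ha ih =>
    rw [Finset.prod_insert ha, Finset.prod_insert ha]
    have h := ih fun i hi => hf i (Finset.mem_insert_of_mem hi)
    exact (Nat.mul_le_mul_left _ h).trans (cyclicPsi_mul_le k (hf a (Finset.mem_insert_self a s))
      (Finset.prod_ne_zero_iff.2 fun i hi => hf i (Finset.mem_insert_of_mem hi)))

/-- The ratio `ψ_k(A₅) / ψ_k(ℤ₆₀)`. -/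
def psiRatio (k : ℕ) : ℚ :=
  (1 + 15 * 2 ^ k + 20 * 3 ^ k + 24 * 5 ^ k : ℚ) /
    ((1 + 2 ^ k + 2 * 4 ^ k) * (1 + 2 * 3 ^ k) * (1 + 4 * 5 ^ k))

theorem psiRatio_nonneg (k : ℕ) : 0 ≤ psiRatio k := by unfold psiRatio; positivity

theorem one_le_psiRatio_mul {k : ℕ} (hk : 4 ≤ k) :
    1 ≤ psiRatio k * (86227 / 124416 * 12 ^ k) := by
  unfold psiRatio
  rw [div_mul_eq_mul_div, one_le_div (by positivity)]
  have h2 : (16 : ℚ) ≤ 2 ^ k := by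
    simpa using (by norm_num : (2 : ℚ) ^ 4 = 16) ▸ pow_le_pow_right₀ (by norm_num : (1 : ℚ) ≤ 2) hk
  have h3 : (81 : ℚ) ≤ 3 ^ k := by
    simpa using (by norm_num : (3 : ℚ) ^ 4 = 81) ▸ pow_le_pow_right₀ (by norm_num : (1 : ℚ) ≤ 3) hk
  have h4 : (4 : ℚ) ^ k = 2 ^ k * 2 ^ k := by rw [← mul_pow]; norm_num
  have h12 : (12 : ℚ) ^ k = 4 ^ k * 3 ^ k := by rw [← mul_pow]; norm_num
  have b4 : (1 + 2 ^ k + 2 * 4 ^ k : ℚ) ≤ 529 / 256 * 4 ^ k := by rw [h4]; nlinarith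
  have b3 : (1 + 2 * 3 ^ k : ℚ) ≤ 163 / 81 * 3 ^ k := by linarith
  have b5 : (1 + 4 * 5 ^ k : ℚ) ≤ (1 + 15 * 2 ^ k + 20 * 3 ^ k + 24 * 5 ^ k) / 6 := by linarith
  calc _ ≤ (529 / 256 * 4 ^ k) * (163 / 81 * 3 ^ k) *
        ((1 + 15 * 2 ^ k + 20 * 3 ^ k + 24 * 5 ^ k) / 6 : ℚ) := by gcongr
    _ = _ := by rw [h12]; ring

/-- The product of `q / (q - 1)` over the primes `q ≤ m`. -/
def primeRatioProd (m : ℕ) : ℚ :=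
  ∏ q ∈ (Finset.range (m + 1)).filter Nat.Prime, (q / (q - 1) : ℚ)

theorem primeRatioProd_pos (m : ℕ) : 0 < primeRatioProd m := by
  refine Finset.prod_pos fun q hq => ?_
  have : (1 : ℚ) < q := by exact_mod_cast (Finset.mem_filter.1 hq).2.one_lt
  exact div_pos (by linarith) (by linarith)

theorem le_totient_mul_primeRatioProd {n m : ℕ} (h : ∀ q, q.Prime → q ∣ n → q ≤ m) :
    (n : ℚ) ≤ n.totient * primeRatioProd m := by
  have hone (q : ℕ) (hq : q.Prime) : (1 : ℚ) < q := by exact_mod_cast hq.one_lt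
  have h1 : (∏ p ∈ n.primeFactors, (1 - (p : ℚ)⁻¹)) * ∏ p ∈ n.primeFactors, (p / (p - 1) : ℚ)
      = 1 := by
    rw [← Finset.prod_mul_distrib]
    refine Finset.prod_eq_one fun q hq => ?_
    have := hone q (Nat.prime_of_mem_primeFactors hq)
    have h0 : (q : ℚ) - 1 ≠ 0 := by linarith
    field_simp
  have h2 : ∏ p ∈ n.primeFactors, (p / (p - 1) : ℚ) ≤ primeRatioProd m := by
    have hsub : n.primeFactors ⊆ (Finset.range (m + 1)).filter Nat.Prime := fun q hq => by
      have hqp := Nat.prime_of_mem_primeFactors hq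
      have := h q hqp (Nat.dvd_of_mem_primeFactors hq)
      simp only [Finset.mem_filter, Finset.mem_range]
      exact ⟨by omega, hqp⟩
    rw [primeRatioProd, ← Finset.prod_sdiff hsub]
    refine le_mul_of_one_le_left (Finset.prod_nonneg ?_) (Finset.one_le_prod ?_)
    · intro q hq
      have := hone q (Nat.prime_of_mem_primeFactors hq)
      exact div_nonneg (by linarith) (by linarith)
    · intro q hq
      have := hone q (Finset.mem_filter.1 (Finset.mem_sdiff.1 hq).1).2
      rw [one_le_div (by linarith)]
      linarith
  calc (n : ℚ) = n.totient * ∏ p ∈ n.primeFactors, (p / (p - 1) : ℚ) := by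
        rw [Nat.totient_eq_mul_prod_factors, mul_assoc, h1, mul_one]
    _ ≤ _ := by gcongr

theorem primeRatioProd_le {m : ℕ} (hm : 17 ≤ m) :
    primeRatioProd m ≤ 124416 / 86227 * (m / 12 : ℚ) ^ 4 := by
  induction m, hm using Nat.le_induction with
  | base =>
    have : (Finset.range (17 + 1)).filter Nat.Prime = {2, 3, 5, 7, 11, 13, 17} := by decide
    norm_num [primeRatioProd, this]
  | succ m hm ih =>
    have hm0 : (0 : ℚ) < m := by exact_mod_cast (by omega : 0 < m)
    have hr : (1 : ℚ) ≤ (m + 1) / m := by rw [one_le_div hm0]; linarith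
    have hstep : primeRatioProd (m + 1) ≤ primeRatioProd m * ((m + 1) / m) := by
      unfold primeRatioProd
      rw [Finset.range_add_one, Finset.filter_insert]
      split_ifs with hp
      · rw [Finset.prod_insert (by simp), mul_comm]
        push_cast
        rw [add_sub_cancel_right]
      · exact le_mul_of_one_le_right (primeRatioProd_pos m).le hr
    calc _ ≤ primeRatioProd m * ((m + 1) / m) := hstep
      _ ≤ 124416 / 86227 * (m / 12 : ℚ) ^ 4 * ((m + 1) / m) ^ 4 := by
        gcongr
        exact le_self_pow₀ hr (by norm_num)
      _ = _ := by
        push_cast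
        field_simp

theorem primeRatioProd_seven : primeRatioProd 7 = 35 / 8 := by
  have : (Finset.range (7 + 1)).filter Nat.Prime = {2, 3, 5, 7} := by decide
  norm_num [primeRatioProd, this]

theorem le_psiRatio_mul_pow {k m : ℕ} (hk : 4 ≤ k) (hm : 12 ≤ m) :
    124416 / 86227 * (m / 12 : ℚ) ^ 4 ≤ psiRatio k * m ^ k := by
  have hm' : (1 : ℚ) ≤ m / 12 := by
    rw [one_le_div (by norm_num)]; exact_mod_cast hm
  calc 124416 / 86227 * (m / 12 : ℚ) ^ 4 ≤ 124416 / 86227 * (m / 12 : ℚ) ^ k := by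
        gcongr
    _ ≤ (psiRatio k * (86227 / 124416 * 12 ^ k)) * (124416 / 86227 * (m / 12 : ℚ) ^ k) :=
        le_mul_of_one_le_left (by positivity) (one_le_psiRatio_mul hk)
    _ = _ := by
        rw [div_pow]
        field_simp

/-- If every prime divisor of `n` is at most `m ≥ 17`, or if it is at most `7` and `m = 16`,
then `n ^ (k + 1) / m ^ k` is at most `psiRatio k * cyclicPsi k n`. -/
theorem pow_le_psiRatio_mul_cyclicPsi {k n m : ℕ} (hk : 4 ≤ k) (hn : n ≠ 0)
    (h : (17 ≤ m ∧ ∀ q, q.Prime → q ∣ n → q ≤ m) ∨ (m = 16 ∧ ∀ q, q.Prime → q ∣ n → q ≤ 7)) :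
    (n : ℚ) * n ^ k ≤ psiRatio k * cyclicPsi k n * m ^ k := by
  obtain ⟨W, hW, hWm⟩ : ∃ W : ℚ, (n : ℚ) ≤ n.totient * W ∧ W ≤ psiRatio k * m ^ k := by
    rcases h with ⟨hm, hq⟩ | ⟨rfl, hq⟩
    · exact ⟨_, le_totient_mul_primeRatioProd hq,
        (primeRatioProd_le hm).trans (le_psiRatio_mul_pow hk (by omega))⟩
    · refine ⟨_, le_totient_mul_primeRatioProd hq,
        le_trans ?_ (le_psiRatio_mul_pow hk (by omega))⟩
      rw [primeRatioProd_seven]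
      norm_num
  have hψ : (n.totient : ℚ) * n ^ k ≤ cyclicPsi k n := by
    exact_mod_cast totient_mul_pow_le_cyclicPsi k hn
  have h0 := psiRatio_nonneg k
  calc (n : ℚ) * n ^ k ≤ n.totient * W * n ^ k := by gcongr
    _ ≤ n.totient * (psiRatio k * m ^ k) * n ^ k := by gcongr
    _ = psiRatio k * (n.totient * n ^ k) * m ^ k := by ring
    _ ≤ _ := by gcongr

/-- The affine function with coefficients `15`, `10`, `6` grows more slowly than the product. -/
theorem affine_mul_prod_le {x₀ y₀ z₀ w₀ x y z w : ℚ} (hx₀ : 2 ≤ x₀) (hy₀ : 3 ≤ y₀) (hz₀ : 5 ≤ z₀)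
    (hw₀ : 0 < w₀) (hx : x₀ ≤ x) (hy : y₀ ≤ y) (hz : z₀ ≤ z) (hw : w₀ ≤ w) :
    (1 + 15 * (x - 1) + 10 * (y - 1) + 6 * (z - 1)) * (x₀ * w₀ * y₀ * z₀) ≤
      (1 + 15 * (x₀ - 1) + 10 * (y₀ - 1) + 6 * (z₀ - 1)) * (x * w * y * z) := by
  have h1 : (1 + 15 * (x - 1) + 10 * (y - 1) + 6 * (z - 1)) * x₀ ≤
      (1 + 15 * (x₀ - 1) + 10 * (y - 1) + 6 * (z - 1)) * x := by
    nlinarith [mul_nonneg (sub_nonneg.2 hx) (by linarith : 0 ≤ 10 * y + 6 * z - 30)]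
  have h2 : (1 + 15 * (x₀ - 1) + 10 * (y - 1) + 6 * (z - 1)) * y₀ ≤
      (1 + 15 * (x₀ - 1) + 10 * (y₀ - 1) + 6 * (z - 1)) * y := by
    nlinarith [mul_nonneg (sub_nonneg.2 hy) (by linarith : 0 ≤ 15 * x₀ + 6 * z - 30)]
  have h3 : (1 + 15 * (x₀ - 1) + 10 * (y₀ - 1) + 6 * (z - 1)) * z₀ ≤
      (1 + 15 * (x₀ - 1) + 10 * (y₀ - 1) + 6 * (z₀ - 1)) * z := by
    nlinarith [mul_nonneg (sub_nonneg.2 hz) (by linarith : 0 ≤ 15 * x₀ + 10 * y₀ - 30)]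
  have hx0 : 0 ≤ x := by linarith
  have hy0 : 0 ≤ y := by linarith
  have hz0 : 0 ≤ z := by linarith
  have hL : 0 ≤ 1 + 15 * (x₀ - 1) + 10 * (y₀ - 1) + 6 * (z₀ - 1) := by linarith
  calc _ = (1 + 15 * (x - 1) + 10 * (y - 1) + 6 * (z - 1)) * x₀ * (w₀ * y₀ * z₀) := by ring
    _ ≤ (1 + 15 * (x₀ - 1) + 10 * (y - 1) + 6 * (z - 1)) * x * (w₀ * y₀ * z₀) := by gcongr
    _ = (1 + 15 * (x₀ - 1) + 10 * (y - 1) + 6 * (z - 1)) * y₀ * (x * w₀ * z₀) := by ring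
    _ ≤ (1 + 15 * (x₀ - 1) + 10 * (y₀ - 1) + 6 * (z - 1)) * y * (x * w₀ * z₀) := by gcongr
    _ = (1 + 15 * (x₀ - 1) + 10 * (y₀ - 1) + 6 * (z - 1)) * z₀ * (x * w₀ * y) := by ring
    _ ≤ (1 + 15 * (x₀ - 1) + 10 * (y₀ - 1) + 6 * (z₀ - 1)) * z * (x * w₀ * y) := by gcongr
    _ ≤ (1 + 15 * (x₀ - 1) + 10 * (y₀ - 1) + 6 * (z₀ - 1)) * z * (x * w * y) := by gcongr
    _ = _ := by ring

/-- The inequality behind the comparison of a central cyclic extension of a simple group of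
order `60` with a cyclic group. -/
theorem cyclicPsi_sum_le_psiRatio_mul (k : ℕ) {n : ℕ} (hn : n ≠ 0) :
    (cyclicPsi k n : ℚ) + 15 * (cyclicPsi k (2 * n) - cyclicPsi k n) +
      10 * (cyclicPsi k (3 * n) - cyclicPsi k n) + 6 * (cyclicPsi k (5 * n) - cyclicPsi k n) ≤
      psiRatio k * cyclicPsi k (60 * n) := by
  have v2 : cyclicPsi k 2 = 1 + 2 ^ k := by
    simp [cyclicPsi, show Nat.divisors 2 = {1, 2} by decide]
  have v3 : cyclicPsi k 3 = 1 + 2 * 3 ^ k := by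
    simp [cyclicPsi, show Nat.divisors 3 = {1, 3} by decide, show Nat.totient 3 = 2 by decide]
  have v4 : cyclicPsi k 4 = 1 + 2 ^ k + 2 * 4 ^ k := by
    simp [cyclicPsi, show Nat.divisors 4 = {1, 2, 4} by decide, show Nat.totient 4 = 2 by decide,
      add_assoc]
  have v5 : cyclicPsi k 5 = 1 + 4 * 5 ^ k := by
    simp [cyclicPsi, show Nat.divisors 5 = {1, 5} by decide, show Nat.totient 5 = 4 by decide]
  have c2 := cyclicPsi_log_convex k (b := 0) Nat.prime_two hn (by simp)
  have c3 := cyclicPsi_log_convex k (b := 0) Nat.prime_three hn (by simp)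
  have c5 := cyclicPsi_log_convex k (b := 0) Nat.prime_five hn (by simp)
  have c4 := cyclicPsi_log_convex k (n := 2 * n) (b := 1) Nat.prime_two (by omega) (by simp)
  have r3 := cyclicPsi_ratio k (u := 4) Nat.prime_three hn (by norm_num)
  have r5 := cyclicPsi_ratio k (u := 12) Nat.prime_five hn (by norm_num)
  simp only [← mul_assoc] at r3 r5 c4
  norm_num [v2, v3, v4, v5, cyclicPsi_one] at c2 c3 c4 c5 r3 r5
  have hA := cyclicPsi_pos k hn
  have hB := cyclicPsi_pos k (n := 2 * n) (by omega)
  generalize cyclicPsi k n = A at *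
  generalize cyclicPsi k (2 * n) = B₂ at *
  generalize cyclicPsi k (3 * n) = B₃ at *
  generalize cyclicPsi k (4 * n) = B₄ at *
  generalize cyclicPsi k (5 * n) = B₅ at *
  generalize cyclicPsi k (12 * n) = C at *
  generalize cyclicPsi k (60 * n) = D at *
  qify at *
  have h2 : (1 : ℚ) ≤ 2 ^ k := one_le_pow₀ (by norm_num)
  have h3 : (1 : ℚ) ≤ 3 ^ k := one_le_pow₀ (by norm_num)
  have h5 : (1 : ℚ) ≤ 5 ^ k := one_le_pow₀ (by norm_num)
  have key := affine_mul_prod_le (x₀ := 1 + 2 ^ k) (y₀ := 1 + 2 * 3 ^ k) (z₀ := 1 + 4 * 5 ^ k)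
    (w₀ := (1 + 2 ^ k + 2 * 4 ^ k) / (1 + 2 ^ k)) (x := B₂ / A) (y := B₃ / A) (z := B₅ / A)
    (w := B₄ / B₂) (by linarith) (by linarith) (by linarith) (by positivity)
    (by rw [le_div_iff₀ hA]; linarith) (by rw [le_div_iff₀ hA]; linarith)
    (by rw [le_div_iff₀ hA]; linarith)
    (by rw [div_le_div_iff₀ (by positivity) hB]; linarith)
  have hD : (D : ℚ) = A * (B₂ / A * (B₄ / B₂) * (B₃ / A) * (B₅ / A)) := by
    field_simp
    have : (D : ℚ) * A * A = B₅ * (C * A) := by rw [r5]; ring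
    rw [sq, ← mul_assoc, this, r3]
    ring
  have e1 : (1 + 2 ^ k) * ((1 + 2 ^ k + 2 * 4 ^ k) / (1 + 2 ^ k)) * (1 + 2 * 3 ^ k) *
      (1 + 4 * 5 ^ k) = ((1 + 2 ^ k + 2 * 4 ^ k) * (1 + 2 * 3 ^ k) * (1 + 4 * 5 ^ k) : ℚ) := by
    field_simp
  rw [e1, ← le_div_iff₀ (by positivity)] at key
  calc _ = A * (1 + 15 * (B₂ / A - 1) + 10 * (B₃ / A - 1) + 6 * (B₅ / A - 1) : ℚ) := by
        field_simp
    _ ≤ _ := mul_le_mul_of_nonneg_left key hA.le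
    _ = _ := by
        rw [hD, psiRatio]
        ring

theorem psi_congr {G H : Type*} [Group G] [Fintype G] [Group H] [Fintype H] (e : G ≃* H)
    (k : ℕ) :
    psi G k = psi H k :=
  Fintype.sum_equiv e.toEquiv _ _ fun g => by
    change orderOf g ^ k = orderOf (e g) ^ k
    rw [MulEquiv.orderOf_eq]

theorem psi_eq_cyclicPsi (G : Type*) [Group G] [Fintype G] [IsCyclic G] (k : ℕ) :
    psi G k = cyclicPsi k (Nat.card G) := by
  classical
  rw [psi, cyclicPsi, Nat.card_eq_fintype_card,
    ← Finset.sum_fiberwise_of_maps_to (t := (Fintype.card G).divisors) (g := orderOf)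
      fun g _ => Nat.mem_divisors.2 ⟨orderOf_dvd_card, Fintype.card_ne_zero⟩]
  refine Finset.sum_congr rfl fun d hd => ?_
  rw [Finset.sum_congr rfl fun g hg => by rw [(Finset.mem_filter.1 hg).2], Finset.sum_const,
    IsCyclic.card_orderOf_eq_totient (Nat.dvd_of_mem_divisors hd), smul_eq_mul]

theorem psi_pi_le {ι : Type*} [Fintype ι] [DecidableEq ι] (M : ι → Type*) [∀ i, Group (M i)]
    [∀ i, Fintype (M i)] (k : ℕ) : psi (∀ i, M i) k ≤ ∏ i, psi (M i) k := by
  unfold psi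
  rw [Finset.prod_univ_sum, Fintype.piFinset_univ]
  refine Finset.sum_le_sum fun x _ => ?_
  rw [Finset.prod_pow]
  refine Nat.pow_le_pow_left (Nat.le_of_dvd (Finset.prod_pos fun i _ => orderOf_pos _) ?_) k
  refine orderOf_dvd_of_pow_eq_one (funext fun i => ?_)
  rw [Pi.pow_apply, Pi.one_apply]
  exact orderOf_dvd_iff_pow_eq_one.1
    (Finset.dvd_prod_of_mem (fun i => orderOf (x i)) (Finset.mem_univ i))

theorem psi_le_cyclicPsi_of_comm (G : Type*) [Group G] [Fintype G] (h : ∀ a b : G, a * b = b * a)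
    (k : ℕ) : psi G k ≤ cyclicPsi k (Nat.card G) := by
  classical
  let _ : CommGroup G := { ‹Group G› with mul_comm := h }
  obtain ⟨ι, _, n, hn, ⟨e⟩⟩ := CommGroup.equiv_prod_multiplicative_zmod_of_finite G
  have (i : ι) : NeZero (n i) := ⟨(zero_lt_one.trans (hn i)).ne'⟩
  rw [psi_congr e, Nat.card_congr e.toEquiv, Nat.card_pi]
  refine (psi_pi_le _ k).trans ?_
  simp only [psi_eq_cyclicPsi]
  exact prod_cyclicPsi_le k _ _ fun i _ => Nat.card_pos.ne'

theorem normal_zpowers_of_mem_cyclic {G : Type*} [Group G] (N : Subgroup G) [N.Normal] [IsCyclic N]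
    (u : N) : (Subgroup.zpowers (u : G)).Normal where
  conj_mem x hx g := by
    obtain ⟨z, rfl⟩ := hx
    obtain ⟨m, hm⟩ := MonoidHom.map_cyclic (MulAut.conjNormal (H := N) g).toMonoidHom
    have h : g * u * g⁻¹ = (u : G) ^ m := by
      have := congrArg (Subtype.val) (hm u)
      simpa using this
    refine ⟨m * z, ?_⟩
    change (u : G) ^ (m * z) = g * (u : G) ^ z * g⁻¹
    rw [zpow_mul, ← h, conj_zpow]

theorem psi_le_mul_of_isComplement' {G : Type*} [Group G] [Fintype G] (N C : Subgroup G) [N.Normal]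
    [IsCyclic N] [Fintype N] [Fintype C] (h : N.IsComplement' C) (k : ℕ) :
    psi G k ≤ psi N k * psi C k := by
  have hdvd (u : N) (c : C) : orderOf ((u : G) * c) ∣ orderOf u * orderOf c := by
    have hnorm := normal_zpowers_of_mem_cyclic N u
    rw [← Subgroup.orderOf_coe u, ← Subgroup.orderOf_coe c]
    apply orderOf_dvd_of_pow_eq_one
    have hmem : ((u : G) * c) ^ orderOf (c : G) ∈ Subgroup.zpowers (u : G) := by
      rw [← QuotientGroup.eq_one_iff]
      have hu : ((u : G) : G ⧸ Subgroup.zpowers (u : G)) = 1 :=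
        (QuotientGroup.eq_one_iff _).2 (Subgroup.mem_zpowers _)
      rw [QuotientGroup.mk_pow, QuotientGroup.mk_mul, hu, one_mul, ← QuotientGroup.mk_pow,
        pow_orderOf_eq_one, QuotientGroup.mk_one]
    rw [mul_comm, pow_mul]
    obtain ⟨z, hz⟩ := hmem
    rw [← hz, ← zpow_natCast, ← zpow_mul, mul_comm, zpow_mul, zpow_natCast,
      pow_orderOf_eq_one, one_zpow]
  unfold psi
  rw [Finset.sum_mul_sum, ← Finset.sum_product',
    ← Fintype.sum_bijective _ h _ _ fun x => rfl]
  refine Finset.sum_le_sum fun x _ => ?_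
  rw [← mul_pow]
  exact Nat.pow_le_pow_left
    (Nat.le_of_dvd (Nat.mul_pos (orderOf_pos _) (orderOf_pos _)) (hdvd _ _)) k


theorem mem_zpowers_symm_of_orderOf_prime {S : Type*} [Group S] {q : ℕ} (hq : q.Prime) {s t : S}
    (hs : orderOf s = q) (ht : t ∈ Subgroup.zpowers s) (h1 : t ≠ 1) :
    orderOf t = q ∧ s ∈ Subgroup.zpowers t := by
  have hst : Subgroup.zpowers t ≤ Subgroup.zpowers s := by simpa using ht
  have hdvd : orderOf t ∣ q := by
    rw [← hs]; exact orderOf_dvd_of_mem_zpowers ht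
  have hq' : orderOf t = q :=
    ((Nat.dvd_prime hq).1 hdvd).resolve_left fun h => h1 (orderOf_eq_one_iff.1 h)
  have : Finite (Subgroup.zpowers s) := by
    have := orderOf_pos_iff.1 (hs ▸ hq.pos)
    exact this.finite_zpowers
  refine ⟨hq', ?_⟩
  rw [Subgroup.eq_of_le_of_card_ge hst (by rw [Nat.card_zpowers, Nat.card_zpowers, hs, hq'])]
  exact Subgroup.mem_zpowers s

theorem card_filter_mem_zpowers {S : Type*} [Group S] [Fintype S] {q : ℕ} (hq : q.Prime) {t : S}
    (ht : orderOf t = q) [DecidablePred fun s : S => orderOf s = q ∧ t ∈ Subgroup.zpowers s] :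
    (Finset.univ.filter fun s : S => orderOf s = q ∧ t ∈ Subgroup.zpowers s).card = q - 1 := by
  classical
  have ht1 : t ≠ 1 := by rintro rfl; exact hq.one_lt.ne (by simpa using ht)
  have h : (Finset.univ.filter fun s : S => orderOf s = q ∧ t ∈ Subgroup.zpowers s)
      = (Finset.univ.filter fun s : S => s ∈ Subgroup.zpowers t).erase 1 := by
    ext s
    simp only [Finset.mem_filter, Finset.mem_univ, true_and, Finset.mem_erase]
    constructor
    · rintro ⟨hs, hts⟩
      refine ⟨?_, (mem_zpowers_symm_of_orderOf_prime hq hs hts ht1).2⟩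
      rintro rfl
      exact hq.one_lt.ne (by simpa using hs)
    · rintro ⟨hs, hts⟩
      exact mem_zpowers_symm_of_orderOf_prime hq ht hts hs
  rw [h, Finset.card_erase_of_mem (by simp), ← ht, ← Nat.card_zpowers,
    Nat.card_eq_fintype_card, Fintype.card_subtype]

theorem sum_orderOf_prime_le {S : Type*} [Group S] [Fintype S] [DecidableEq S] {q : ℕ}
    (hq : q.Prime) (T : S → ℕ) (B : ℕ)
    [∀ s : S, DecidablePred fun t : S => t ∈ Subgroup.zpowers s]
    (hB : ∀ s, orderOf s = q → ∑ t with t ∈ Subgroup.zpowers s, T t ≤ B) :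
    (q - 1) * (∑ t with orderOf t = q, T t) + Nat.card {s : S // orderOf s = q} * T 1 ≤
      Nat.card {s : S // orderOf s = q} * B := by
  have hsplit (s : S) (hs : orderOf s = q) : ∑ t with t ∈ Subgroup.zpowers s, T t =
      (∑ t with orderOf t = q, if t ∈ Subgroup.zpowers s then T t else 0) + T 1 := by
    rw [← Finset.sum_erase_add _ (a := 1) _ (by simp), ← Finset.sum_filter,
      Finset.filter_filter]
    congr 1
    refine Finset.sum_congr ?_ fun _ _ => rfl
    ext t
    simp only [Finset.mem_filter, Finset.mem_univ, true_and, Finset.mem_erase]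
    constructor
    · rintro ⟨h1, ht⟩
      exact ⟨(mem_zpowers_symm_of_orderOf_prime hq hs ht h1).1, ht⟩
    · rintro ⟨ht, h⟩
      refine ⟨?_, h⟩
      rintro rfl
      exact hq.one_lt.ne (by simpa using ht)
  have hcount : (q - 1) * (∑ t with orderOf t = q, T t) =
      ∑ s with orderOf s = q, ∑ t with orderOf t = q,
        if t ∈ Subgroup.zpowers s then T t else 0 := by
    rw [Finset.sum_comm, Finset.mul_sum]
    refine Finset.sum_congr rfl fun t ht => ?_
    rw [← Finset.sum_filter, Finset.filter_filter, Finset.sum_const,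
      card_filter_mem_zpowers hq (Finset.mem_filter.1 ht).2, smul_eq_mul]
  have hcard : Nat.card {s : S // orderOf s = q} =
      (Finset.univ.filter fun s : S => orderOf s = q).card := by
    rw [Nat.card_eq_fintype_card, Fintype.card_subtype]
  rw [hcount, hcard, ← smul_eq_mul, ← Finset.sum_const, ← Finset.sum_add_distrib, ← smul_eq_mul]
  refine Finset.sum_le_card_nsmul _ _ _ fun s hs => ?_
  rw [← hsplit s (Finset.mem_filter.1 hs).2]
  exact hB s (Finset.mem_filter.1 hs).2

theorem psi_subgroup {G : Type*} [Group G] [Fintype G] (H : Subgroup G) [Fintype H]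
    [DecidablePred (· ∈ H)] (k : ℕ) : psi H k = ∑ g with g ∈ H, orderOf g ^ k := by
  rw [psi, Finset.sum_subtype (p := (· ∈ H)) _ (by simp)]
  exact Finset.sum_congr rfl fun g _ => by rw [Subgroup.orderOf_coe]

theorem psi_comap_eq_sum {G S : Type*} [Group G] [Fintype G] [Group S] [Fintype S] [DecidableEq S]
    (f : G →* S) (L : Subgroup S) [DecidablePred (· ∈ L)] [Fintype (L.comap f)] (k : ℕ) :
    psi (L.comap f) k = ∑ t with t ∈ L, ∑ g with f g = t, orderOf g ^ k := by
  classical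
  rw [Finset.sum_fiberwise_eq_sum_filter, psi_subgroup]
  simp [Subgroup.mem_comap]

theorem card_comap_of_surjective {G S : Type*} [Group G] [Finite G] [Group S]
    (f : G →* S) (hf : Function.Surjective f) (L : Subgroup S) :
    Nat.card (L.comap f) = Nat.card L * Nat.card f.ker := by
  have := Finite.of_surjective f hf
  have h1 := (L.comap f).card_mul_index
  have h2 := f.ker.card_mul_index
  have h3 := L.card_mul_index
  rw [Subgroup.index_comap_of_surjective _ hf] at h1
  rw [Subgroup.index_ker, MonoidHom.range_eq_top.2 hf, Subgroup.card_top] at h2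
  refine Nat.eq_of_mul_eq_mul_right (Nat.pos_of_ne_zero L.index_ne_zero_of_finite) ?_
  rw [h1, ← h2, ← h3]
  ring

theorem psi_central_extension {G S : Type*} [Group G] [Fintype G] [Group S] [Fintype S]
    (f : G →* S) (hf : Function.Surjective f) (hcyc : IsCyclic f.ker)
    (hcen : f.ker ≤ Subgroup.center G)
    (hS : ∀ s : S, s ≠ 1 → orderOf s = 2 ∨ orderOf s = 3 ∨ orderOf s = 5)
    (h2 : Nat.card {s : S // orderOf s = 2} = 15)
    (h3 : Nat.card {s : S // orderOf s = 3} = 20)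
    (h5 : Nat.card {s : S // orderOf s = 5} = 24)
    (h60 : Nat.card S = 60) (k : ℕ) :
    (psi G k : ℚ) ≤ psiRatio k * cyclicPsi k (Nat.card G) := by
  classical
  let T : S → ℕ := fun s => ∑ g with f g = s, orderOf g ^ k
  set κ := Nat.card f.ker with hκ
  have hT1 : T 1 = cyclicPsi k κ := by
    rw [← psi_eq_cyclicPsi, psi_subgroup]
    simp only [MonoidHom.mem_ker, T]
  have hB (q : ℕ) (s : S) (hs : orderOf s = q) :
      ∑ t with t ∈ Subgroup.zpowers s, T t ≤ cyclicPsi k (q * κ) := by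
    rw [← psi_comap_eq_sum f, ← hs, ← Nat.card_zpowers, ← card_comap_of_surjective f hf]
    refine psi_le_cyclicPsi_of_comm _ (fun a b => ?_) k
    let g := f.subgroupComap (Subgroup.zpowers s)
    have hg : g.ker ≤ Subgroup.center _ := by
      intro x hx
      rw [Subgroup.mem_center_iff]
      intro y
      have hx' : (x : G) ∈ f.ker := congrArg Subtype.val hx
      exact Subtype.ext (Subgroup.mem_center_iff.1 (hcen hx') y)
    exact (MonoidHom.isMulCommutative_of_isCyclic_of_ker_le_center g hg).is_comm.comm a b
  have hpsi : psi G k = T 1 + (∑ t with orderOf t = 2, T t) + (∑ t with orderOf t = 3, T t)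
      + ∑ t with orderOf t = 5, T t := by
    rw [psi, ← Finset.sum_fiberwise Finset.univ f,
      ← Finset.add_sum_erase Finset.univ _ (Finset.mem_univ (1 : S))]
    simp only [add_assoc]
    congr 1
    rw [← Finset.sum_union, ← Finset.sum_union]
    · refine Finset.sum_congr ?_ fun _ _ => rfl
      ext t
      simp only [Finset.mem_erase, Finset.mem_univ, and_true, Finset.mem_union, Finset.mem_filter,
        true_and]
      refine ⟨hS t, ?_⟩
      rintro h rfl
      simp at h
    · rw [Finset.disjoint_left]
      intro t
      simp only [Finset.mem_filter, Finset.mem_union]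
      omega
    · rw [Finset.disjoint_left]
      intro t
      simp only [Finset.mem_filter]
      omega
  have hcard : Nat.card G = 60 * κ := by
    rw [← Subgroup.card_top (G := G), ← Subgroup.comap_top f, card_comap_of_surjective f hf,
      Subgroup.card_top, h60]
  have b2 := sum_orderOf_prime_le Nat.prime_two T _ (hB 2)
  have b3 := sum_orderOf_prime_le Nat.prime_three T _ (hB 3)
  have b5 := sum_orderOf_prime_le Nat.prime_five T _ (hB 5)
  rw [h2, hT1] at b2
  rw [h3, hT1] at b3
  rw [h5, hT1] at b5
  rw [hcard]
  refine le_trans ?_ (cyclicPsi_sum_le_psiRatio_mul k (n := κ) Nat.card_pos.ne')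
  rw [hpsi, hT1]
  have b2' := (Nat.cast_le (α := ℚ)).2 b2
  have b3' := (Nat.cast_le (α := ℚ)).2 b3
  have b5' := (Nat.cast_le (α := ℚ)).2 b5
  push_cast at b2' b3' b5' ⊢
  linarith

theorem multiset_lcm_le_six {s : Multiset ℕ} (h2 : ∀ a ∈ s, 2 ≤ a) (hs : s.sum ≤ 6) :
    s.lcm ≤ 6 := by
  rcases s.empty_or_exists_mem with rfl | ⟨a, ha⟩
  · simp
  obtain ⟨s, rfl⟩ := Multiset.exists_cons_of_mem ha
  have ha2 := h2 a ha
  rw [Multiset.sum_cons] at hs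
  rcases s.empty_or_exists_mem with rfl | ⟨b, hb⟩
  · simpa using hs
  obtain ⟨s, rfl⟩ := Multiset.exists_cons_of_mem hb
  have hb2 := h2 b (by simp)
  rw [Multiset.sum_cons] at hs
  rcases s.empty_or_exists_mem with rfl | ⟨c, hc⟩
  · simp only [Multiset.sum_zero, add_zero] at hs
    simp only [Multiset.lcm_cons, Multiset.lcm_zero]
    have ha4 : a ≤ 4 := by omega
    have hb4 : b ≤ 4 := by omega
    interval_cases a <;> interval_cases b <;> simp_all [lcm, Nat.lcm]
  obtain ⟨s, rfl⟩ := Multiset.exists_cons_of_mem hc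
  have hc2 := h2 c (by simp)
  rw [Multiset.sum_cons] at hs
  rcases s.empty_or_exists_mem with rfl | ⟨d, hd⟩
  · obtain ⟨rfl, rfl, rfl⟩ : a = 2 ∧ b = 2 ∧ c = 2 := by omega
    simp
  · have := h2 d (by simp [hd])
    have := Multiset.le_sum_of_mem hd
    omega

theorem orderOf_perm_le_six {α : Type*} [Fintype α] [DecidableEq α] (hα : Fintype.card α ≤ 7)
    (σ : Equiv.Perm α) {x : α} (hx : σ x = x) : orderOf σ ≤ 6 := by
  rw [← Equiv.Perm.lcm_cycleType]
  refine multiset_lcm_le_six (fun a => Equiv.Perm.two_le_of_mem_cycleType) ?_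
  rw [Equiv.Perm.sum_cycleType]
  have : σ.support.card < Fintype.card α :=
    Finset.card_lt_univ_of_notMem (x := x) (by simpa using hx)
  omega

theorem mul_eq_sixty {r d h : ℕ} (hr : 2 ≤ r) (hd : 5 ≤ d) (hrd : r * d ≤ 15) (h0 : 0 < h)
    (h6 : h ≤ 6) (hdvd : 2 * (h * (r * d)) ∣ d.factorial)
    (hsylow : ∀ p : ℕ, p.Prime → p ∣ h * (r * d) → ∃ t c, t * (p * c) = h * (r * d) ∧ 5 ≤ t ∧
      t % p = 1 ∧ (¬ p ^ 2 ∣ h * (r * d) → c ≠ 1)) : h * (r * d) = 60 := by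
  have hsmall (p n : ℕ) (hp : p.Prime) (hn : h * (r * d) = n) (hpn : p ∣ n)
      (hcond : ∀ t < n / p + 1, 5 ≤ t → t % p = 1 → t * p ∣ n → ¬ p ^ 2 ∣ n ∧ t * p = n) :
      False := by
    obtain ⟨t, c, h1, h2, h3, h4⟩ := hsylow p hp (hn ▸ hpn)
    rw [hn] at h1 h4
    have hn0 : n ≠ 0 := by
      rw [← hn]
      positivity
    have hc : 0 < c := Nat.pos_of_ne_zero fun hc => hn0 (by rw [← h1, hc, mul_zero, mul_zero])
    have htp : t * p ∣ n := ⟨c, by rw [← h1, mul_assoc]⟩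
    have hlt : t < n / p + 1 := by
      rw [Nat.lt_succ_iff, Nat.le_div_iff_mul_le hp.pos]
      exact Nat.le_of_dvd hn0.bot_lt htp
    obtain ⟨h5, h6⟩ := hcond t hlt h2 h3 htp
    refine h4 h5 (Nat.eq_of_mul_eq_mul_left (Nat.mul_pos (by omega : 0 < t) hp.pos) ?_)
    rw [mul_assoc, h1, mul_one, h6]
  have hr3 : r ≤ 3 := by nlinarith
  have hd7 : d ≤ 7 := by nlinarith
  interval_cases r <;> interval_cases d <;> first | omega | skip
  all_goals interval_cases h <;> first | rfl | (norm_num [Nat.factorial] at hdvd; done) | exfalso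
  · exact hsmall 5 10 (by norm_num) rfl (by decide) (by decide)
  · exact hsmall 5 20 (by norm_num) rfl (by decide) (by decide)
  · exact hsmall 5 30 (by norm_num) rfl (by decide) (by decide)
  · exact hsmall 3 12 (by norm_num) rfl (by decide) (by decide)
  · exact hsmall 3 24 (by norm_num) rfl (by decide) (by decide)
  · exact hsmall 3 36 (by norm_num) rfl (by decide) (by decide)
  · exact hsmall 3 72 (by norm_num) rfl (by decide) (by decide)
  · exact hsmall 7 14 (by norm_num) rfl (by decide) (by decide)
  · exact hsmall 7 28 (by norm_num) rfl (by decide) (by decide)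
  · exact hsmall 7 42 (by norm_num) rfl (by decide) (by decide)
  · exact hsmall 7 56 (by norm_num) rfl (by decide) (by decide)
  · exact hsmall 7 70 (by norm_num) rfl (by decide) (by decide)
  · exact hsmall 7 84 (by norm_num) rfl (by decide) (by decide)
  · exact hsmall 5 15 (by norm_num) rfl (by decide) (by decide)
  · exact hsmall 5 30 (by norm_num) rfl (by decide) (by decide)

theorem card_sylow_eq_of_not_sq_dvd {G : Type*} [Group G] [Finite G] {p : ℕ} [Fact p.Prime]
    (hp : p ∣ Nat.card G) (hp2 : ¬ p ^ 2 ∣ Nat.card G) (P : Sylow p G) : Nat.card P = p := by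
  have hpr : p.Prime := Fact.out
  have h1 := (hpr.dvd_iff_one_le_factorization Nat.card_pos.ne').1 hp
  have h2 := mt (hpr.pow_dvd_iff_le_factorization Nat.card_pos.ne').2 hp2
  rw [P.card_eq_multiplicity, show (Nat.card G).factorization p = 1 by omega, pow_one]

theorem card_orderOf_eq_prime_of_not_sq_dvd {G : Type*} [Group G] [Finite G] {p : ℕ} [Fact p.Prime]
    (hp : p ∣ Nat.card G) (hp2 : ¬ p ^ 2 ∣ Nat.card G) :
    Nat.card {x : G // orderOf x = p} = Nat.card (Sylow p G) * (p - 1) := by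
  classical
  have := Fintype.ofFinite (Sylow p G)
  have hpr : p.Prime := Fact.out
  have hcard := card_sylow_eq_of_not_sq_dvd hp hp2
  have horder (P : Sylow p G) (x : G) (hx : x ∈ P) (h1 : x ≠ 1) : orderOf x = p := by
    have : orderOf x ∣ p := by
      rw [← hcard P, ← Subgroup.orderOf_mk x hx]
      exact orderOf_dvd_natCard _
    exact ((Nat.dvd_prime hpr).1 this).resolve_left fun h => h1 (orderOf_eq_one_iff.1 h)
  have hzpow (P : Sylow p G) (x : G) (hx : x ∈ P) (h1 : x ≠ 1) :
      Subgroup.zpowers x = (P : Subgroup G) :=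
    Subgroup.eq_of_le_of_card_ge ((Subgroup.zpowers_le).2 hx)
      (by rw [Nat.card_zpowers, horder P x hx h1]; exact (hcard P).le)
  let F : (Σ P : Sylow p G, {x : P // x ≠ 1}) → {x : G // orderOf x = p} :=
    fun y => ⟨y.2.1.1, horder y.1 _ y.2.1.2 fun h => y.2.2 (Subtype.ext h)⟩
  have hF : Function.Bijective F := by
    constructor
    · rintro ⟨P, ⟨x, hx⟩, hx1⟩ ⟨Q, ⟨y, hy⟩, hy1⟩ h
      obtain rfl : x = y := congrArg Subtype.val h
      have h1 : x ≠ 1 := fun h => hx1 (Subtype.ext h)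
      obtain rfl : P = Q := Sylow.ext ((hzpow P x hx h1).symm.trans (hzpow Q x hy h1))
      rfl
    · rintro ⟨x, hx⟩
      have hpg : IsPGroup p (Subgroup.zpowers x) :=
        IsPGroup.of_card (n := 1) (by rw [Nat.card_zpowers, hx, pow_one])
      obtain ⟨P, hP⟩ := hpg.exists_le_sylow
      refine ⟨⟨P, ⟨x, hP (Subgroup.mem_zpowers x)⟩, fun h => ?_⟩, rfl⟩
      have hx1 : x = 1 := congrArg Subtype.val h
      rw [hx1, orderOf_one] at hx
      exact hpr.one_lt.ne hx
  rw [← Nat.card_eq_of_bijective F hF, Nat.card_sigma]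
  have hsub (P : Sylow p G) : Nat.card {x : P // x ≠ 1} = p - 1 := by
    have := Fintype.ofFinite P
    rw [Nat.card_eq_fintype_card, Fintype.card_subtype_compl, Fintype.card_subtype_eq,
      ← Nat.card_eq_fintype_card]
    exact congrArg (· - 1) (hcard P)
  simp only [hsub, Finset.sum_const, Finset.card_univ, smul_eq_mul, Nat.card_eq_fintype_card]

theorem injective_toPermHom_of_ne_top {S : Type*} [Group S] [IsSimpleGroup S] {M : Subgroup S}
    (hM : M ≠ ⊤) : Function.Injective (MulAction.toPermHom S (S ⧸ M)) := by
  rw [← MonoidHom.ker_eq_bot_iff, ← Subgroup.normalCore_eq_ker]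
  refine (Subgroup.Normal.eq_bot_or_eq_top M.normalCore_normal).resolve_right fun h => hM ?_
  exact top_le_iff.1 (h ▸ M.normalCore_le)

section SimpleGroups

variable {S : Type*} [Group S] [Finite S]

theorem isSolvable_of_isPGroup {p : ℕ} [Fact p.Prime] (h : IsPGroup p S) : Group.IsSolvable S :=
  have := h.isNilpotent
  inferInstance

theorem isSolvable_of_sylow_eq_top (p : ℕ) [Fact p.Prime] (P : Sylow p S)
    (h : (P : Subgroup S) = ⊤) : Group.IsSolvable S := by
  refine isSolvable_of_isPGroup (p := p) fun g => ?_
  obtain ⟨m, hm⟩ := P.isPGroup' ⟨g, h ▸ Subgroup.mem_top g⟩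
  exact ⟨m, congrArg Subtype.val hm⟩

variable [IsSimpleGroup S]

theorem orderOf_generator_le_six {M : Subgroup S} (hM : M ≠ ⊤) (hd : M.index ≤ 7) {x : S}
    (hx : x ∈ M) : orderOf x ≤ 6 := by
  classical
  have := Fintype.ofFinite (S ⧸ M)
  have hφ := injective_toPermHom_of_ne_top hM
  rw [← orderOf_injective _ hφ x]
  refine orderOf_perm_le_six ?_ _ (x := ((1 : S) : S ⧸ M)) ?_
  · rwa [← Nat.card_eq_fintype_card]
  · rw [MulAction.toPermHom_apply, MulAction.toPerm_apply, MulAction.Quotient.smul_coe,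
      QuotientGroup.eq]
    simpa using hx

theorem two_mul_card_dvd_factorial_index (hS : ¬ Group.IsSolvable S) {M : Subgroup S} (hM : M ≠ ⊤) :
    2 * Nat.card S ∣ M.index.factorial := by
  classical
  have := Fintype.ofFinite (S ⧸ M)
  have hnt : Nontrivial (S ⧸ M) := by
    rw [← Finite.one_lt_card_iff_nontrivial]
    have h1 : Nat.card (S ⧸ M) ≠ 1 := fun h => hM (Subgroup.index_eq_one.1 h)
    have h2 : 0 < Nat.card (S ⧸ M) := Nat.card_pos
    omega
  let φ := MulAction.toPermHom S (S ⧸ M)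
  have hφ : Function.Injective φ := injective_toPermHom_of_ne_top hM
  have hsign (x : S) : Equiv.Perm.sign (φ x) = 1 := by
    have hker : (Equiv.Perm.sign.comp φ).ker = ⊤ := by
      refine (Subgroup.Normal.eq_bot_or_eq_top (MonoidHom.normal_ker _)).resolve_left fun h => hS ?_
      refine Group.isSolvable_of_comm fun a b => ?_
      rw [MonoidHom.ker_eq_bot_iff] at h
      exact h (by simp only [map_mul, mul_comm])
    have hx : x ∈ (Equiv.Perm.sign.comp φ).ker := hker ▸ Subgroup.mem_top x
    exact hx
  let ψ : S →* alternatingGroup (S ⧸ M) := φ.codRestrict _ hsign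
  have hψ : Function.Injective ψ := fun a b h => hφ (congrArg Subtype.val h)
  have h := Subgroup.card_dvd_of_injective ψ hψ
  have h' := Nat.mul_dvd_mul_left 2 h
  rwa [two_mul_nat_card_alternatingGroup, Nat.card_perm] at h'

theorem five_le_index (hS : ¬ Group.IsSolvable S) {M : Subgroup S} (hM : M ≠ ⊤) : 5 ≤ M.index := by
  by_contra! hlt
  have hdvd := two_mul_card_dvd_factorial_index hS hM
  have hpos : 0 < Nat.card S := Nat.card_pos
  have h12 : Nat.card S ∣ 12 := by
    have h24 : M.index.factorial ∣ 24 := Nat.factorial_dvd_factorial (by omega : M.index ≤ 4)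
    have := hdvd.trans h24
    exact Nat.dvd_of_mul_dvd_mul_left two_pos this
  obtain ⟨P⟩ : Nonempty (Sylow 2 S) := inferInstance
  have hPtop : (P : Subgroup S) ≠ ⊤ := fun h => hS (isSolvable_of_sylow_eq_top 2 P h)
  have hodd : ¬ 2 ∣ (P : Subgroup S).index := P.not_dvd_index
  have hP12 : (P : Subgroup S).index ∣ 12 := (Subgroup.index_dvd_card _).trans h12
  have hP3 : (P : Subgroup S).index ∣ 3 :=
    (Nat.Coprime.dvd_of_dvd_mul_left (m := 4)
      (Nat.Coprime.pow_right 2 ((Nat.Prime.coprime_iff_not_dvd Nat.prime_two).2 hodd).symm) hP12)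
  have hP : (P : Subgroup S).index = 3 :=
    ((Nat.dvd_prime Nat.prime_three).1 hP3).resolve_left fun h => hPtop (Subgroup.index_eq_one.1 h)
  have h6 := two_mul_card_dvd_factorial_index hS hPtop
  rw [hP] at h6
  have h3 : Nat.card S ∣ 3 := Nat.dvd_of_mul_dvd_mul_left two_pos (h6 : 2 * Nat.card S ∣ 2 * 3)
  have := (P : Subgroup S).card_mul_index
  rw [hP] at this
  have hS3 : Nat.card S = 3 := by
    have := Nat.le_of_dvd (by norm_num) h3
    have : 0 < Nat.card (P : Subgroup S) := Nat.card_pos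
    omega
  have : Fact (Nat.Prime 3) := ⟨Nat.prime_three⟩
  exact hS (isSolvable_of_isPGroup (IsPGroup.of_card (n := 1) (p := 3) (by simpa using hS3)))

theorem not_normalizer_le_centralizer (hS : ¬ Group.IsSolvable S)
    {p : ℕ} [Fact p.Prime] (hp : p ∣ Nat.card S)
    (P : Sylow p S) :
    ¬ Subgroup.normalizer (P : Set S) ≤ Subgroup.centralizer (P : Set S) := by
  intro h
  have hc := MonoidHom.ker_transferSylow_isComplement' P h
  rcases Subgroup.Normal.eq_bot_or_eq_top (MonoidHom.normal_ker (MonoidHom.transferSylow P h))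
    with hk | hk
  · rw [hk, Subgroup.isComplement'_bot_left] at hc
    exact hS (isSolvable_of_sylow_eq_top p P hc)
  · rw [hk, Subgroup.isComplement'_top_left] at hc
    exact P.ne_bot_of_dvd_card hp hc

theorem normalizer_sylow_ne_top (hS : ¬ Group.IsSolvable S)
    {p : ℕ} [Fact p.Prime] (hp : p ∣ Nat.card S) (P : Sylow p S) :
    Subgroup.normalizer (P : Set S) ≠ ⊤ := by
  intro h
  rcases Subgroup.Normal.eq_bot_or_eq_top (Subgroup.normalizer_eq_top_iff.1 h) with hk | hk
  · exact P.ne_bot_of_dvd_card hp hk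
  · exact hS (isSolvable_of_sylow_eq_top p P hk)

theorem exists_card_sylow_mul (hS : ¬ Group.IsSolvable S)
    (p : ℕ) [Fact p.Prime] (hp : p ∣ Nat.card S) :
    ∃ c, Nat.card (Sylow p S) * c = Nat.card S ∧ p ∣ c ∧ 5 ≤ Nat.card (Sylow p S) ∧
      Nat.card (Sylow p S) % p = 1 := by
  obtain ⟨P⟩ : Nonempty (Sylow p S) := inferInstance
  refine ⟨Nat.card (Subgroup.normalizer (P : Set S)), ?_, ?_, ?_, ?_⟩
  · rw [P.card_eq_index_normalizer, mul_comm, Subgroup.card_mul_index]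
  · exact (P.dvd_card_of_dvd_card hp).trans (Subgroup.card_dvd_of_le Subgroup.le_normalizer)
  · rw [P.card_eq_index_normalizer]
    exact five_le_index hS (normalizer_sylow_ne_top hS hp P)
  · have h := card_sylow_modEq_one p S
    rwa [Nat.ModEq, Nat.mod_eq_of_lt (Fact.out (p := p.Prime)).one_lt] at h

/-- If `p` exactly divides the order of `S`, then the normalizer of a subgroup of order `p` is not
cyclic. -/
theorem exists_card_sylow_mul_of_orderOf (hS : ¬ Group.IsSolvable S)
    {p : ℕ} [Fact p.Prime] (hp2 : ¬ p ^ 2 ∣ Nat.card S) {x : S}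
    (hx : p ∣ orderOf x) :
    ∃ c, Nat.card (Sylow p S) * c = Nat.card S ∧ orderOf x ∣ c ∧ orderOf x ≠ c := by
  have hpr : p.Prime := Fact.out
  obtain ⟨r, hr⟩ := hx
  have hxpos := orderOf_pos x
  have hr0 : r ≠ 0 := by rintro rfl; simp [hr] at hxpos
  have hpS : p ∣ Nat.card S := (Dvd.intro r hr.symm).trans (orderOf_dvd_natCard x)
  have hy : orderOf (x ^ r) = p := by
    rw [orderOf_pow_of_dvd hr0 ⟨p, by rw [hr, mul_comm]⟩, hr, Nat.mul_div_cancel _ hr0.bot_lt]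
  let P : Sylow p S := Sylow.ofCard (Subgroup.zpowers (x ^ r)) (by
    have : (Nat.card S).factorization p = 1 := by
      have h1 := (hpr.dvd_iff_one_le_factorization Nat.card_pos.ne').1 hpS
      have h2 := mt (hpr.pow_dvd_iff_le_factorization Nat.card_pos.ne').2 hp2
      omega
    rw [Nat.card_zpowers, hy, this, pow_one])
  have hP : (P : Subgroup S) = Subgroup.zpowers (x ^ r) := Sylow.coe_ofCard _ _
  have hcen : Subgroup.zpowers x ≤ Subgroup.centralizer (P : Set S) := by
    rw [Subgroup.zpowers_le, Subgroup.mem_centralizer_iff]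
    intro y hy
    have hy' : y ∈ (P : Subgroup S) := hy
    rw [hP] at hy'
    obtain ⟨i, rfl⟩ := hy'
    exact (((Commute.refl x).pow_left r).zpow_left i).eq
  have hcn := Subgroup.centralizer_le_normalizer (P : Set S)
  refine ⟨Nat.card (Subgroup.normalizer (P : Set S)), ?_, ?_, ?_⟩
  · rw [P.card_eq_index_normalizer, mul_comm, Subgroup.card_mul_index]
  · rw [← Nat.card_zpowers]
    exact Subgroup.card_dvd_of_le (hcen.trans hcn)
  · intro h
    rw [← Nat.card_zpowers] at h
    have := Subgroup.eq_of_le_of_card_ge (hcen.trans hcn) h.ge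
    exact not_normalizer_le_centralizer hS hpS P (this ▸ hcen)

theorem exists_between_of_isCyclic (hS : ¬ Group.IsSolvable S)
    {H : Subgroup S} [IsCyclic H] (hH : H ≠ ⊥) :
    ∃ M, H < M ∧ M ≠ ⊤ := by
  have hcomm {a b : S} (ha : a ∈ H) (hb : b ∈ H) : a * b = b * a :=
    congrArg Subtype.val (IsCyclic.isMulCommutative.is_comm.comm (⟨a, ha⟩ : H) ⟨b, hb⟩)
  have hHtop : H ≠ ⊤ := by
    rintro rfl
    exact hS (Group.isSolvable_of_comm fun a b => hcomm (Subgroup.mem_top a) (Subgroup.mem_top b))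
  obtain ⟨q, hq, hqH⟩ := Nat.exists_prime_and_dvd (mt Subgroup.card_eq_one.1 hH)
  have : Fact q.Prime := ⟨hq⟩
  obtain ⟨Q⟩ : Nonempty (Sylow q H) := inferInstance
  let R : Subgroup S := (Q : Subgroup H).map H.subtype
  have hRH : R ≤ H := Subgroup.map_subtype_le _
  have hRcard : Nat.card R = q ^ (Nat.card H).factorization q := by
    rw [Subgroup.card_map_of_injective H.subtype_injective, Q.card_eq_multiplicity]
  have hR1 : R ≠ ⊥ := by
    intro h
    rw [Subgroup.map_eq_bot_iff_of_injective _ H.subtype_injective] at h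
    exact Q.ne_bot_of_dvd_card hqH h
  have hHC : H ≤ Subgroup.centralizer (R : Set S) := fun a ha b hb => hcomm (hRH hb) ha
  have hHN := hHC.trans (Subgroup.centralizer_le_normalizer _)
  refine ⟨Subgroup.normalizer (R : Set S), lt_of_le_of_ne hHN fun h => ?_, fun h => ?_⟩
  · have hnd : ¬ q ^ ((Nat.card H).factorization q + 1) ∣ Nat.card S := by
      intro hd
      have := Sylow.prime_pow_dvd_card_normalizer hd hRcard
      rw [← h] at this
      exact Nat.pow_succ_factorization_not_dvd Nat.card_pos.ne' hq this
    have hfac : (Nat.card S).factorization q = (Nat.card H).factorization q := by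
      have h1 := mt (hq.pow_dvd_iff_le_factorization Nat.card_pos.ne').2 hnd
      have h2 := (Nat.factorization_le_iff_dvd Nat.card_pos.ne' Nat.card_pos.ne').2
        H.card_subgroup_dvd_card q
      omega
    let P : Sylow q S := Sylow.ofCard R (by rw [hRcard, hfac])
    have hP : (P : Subgroup S) = R := Sylow.coe_ofCard _ _
    refine not_normalizer_le_centralizer hS (hqH.trans H.card_subgroup_dvd_card) P ?_
    have hP' : (P : Set S) = R := congrArg (fun K : Subgroup S => (K : Set S)) hP
    rw [hP', ← h]
    exact hHC
  · rcases Subgroup.Normal.eq_bot_or_eq_top (Subgroup.normalizer_eq_top_iff.1 h) with hk | hk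
    · exact hR1 hk
    · exact hHtop (top_le_iff.1 (hk ▸ hRH))

theorem exists_sylow_arithmetic (hS : ¬ Group.IsSolvable S)
    (p : ℕ) (hp : p.Prime) (hpS : p ∣ Nat.card S) :
    ∃ t c, t * (p * c) = Nat.card S ∧ 5 ≤ t ∧ t % p = 1 ∧ (¬ p ^ 2 ∣ Nat.card S → c ≠ 1) := by
  have : Fact p.Prime := ⟨hp⟩
  obtain ⟨_, h1, ⟨c, rfl⟩, h5, hmod⟩ := exists_card_sylow_mul hS p hpS
  refine ⟨_, c, h1, h5, hmod, ?_⟩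
  rintro hp2 rfl
  obtain ⟨x, hx⟩ := exists_prime_orderOf_dvd_card' p hpS
  obtain ⟨c, h1', h2, h3⟩ := exists_card_sylow_mul_of_orderOf hS hp2 (x := x) hx.symm.dvd
  rw [hx] at h3
  refine h3 (Nat.eq_of_mul_eq_mul_left (by omega : 0 < Nat.card (Sylow p S)) ?_)
  rw [h1', ← h1, mul_one]

theorem card_eq_sixty_of_isCyclic_of_ne_bot (hS : ¬ Group.IsSolvable S)
    {H : Subgroup S} [IsCyclic H] (hH : H ≠ ⊥)
    (hm : H.index ≤ 15) : Nat.card S = 60 := by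
  obtain ⟨M, hHM, hM⟩ := exists_between_of_isCyclic hS hH
  have hd5 := five_le_index hS hM
  have hdvd := two_mul_card_dvd_factorial_index hS hM
  have hidx := Subgroup.relIndex_mul_index hHM.le
  have hr1 : H.relIndex M ≠ 1 := fun h => hHM.not_ge (Subgroup.relIndex_eq_one.1 h)
  have hcard := H.card_mul_index
  have hr0 : H.relIndex M ≠ 0 := fun h =>
    Subgroup.index_ne_zero_of_finite (H := H) (by rw [← hidx, h, zero_mul])
  have hd7 : M.index ≤ 7 := by
    have : 2 ≤ H.relIndex M := by omega
    nlinarith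
  obtain ⟨x, hx⟩ := IsCyclic.exists_generator (α := H)
  have hcx : Nat.card H = orderOf (x : S) := by
    rw [Subgroup.orderOf_coe, orderOf_eq_card_of_forall_mem_zpowers hx]
  have hh6 : Nat.card H ≤ 6 := hcx ▸ orderOf_generator_le_six hM hd7 (hHM.le x.2)
  have hh0 : 0 < Nat.card H := Nat.card_pos
  have key := exists_sylow_arithmetic hS
  rw [← hcard, ← hidx] at hdvd key ⊢
  rw [← hidx] at hm
  exact mul_eq_sixty (by omega) hd5 hm hh0 hh6 hdvd key

theorem card_eq_sixty_of_isCyclic (hS : ¬ Group.IsSolvable S)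
    {H : Subgroup S} [IsCyclic H] (hm : H.index ≤ 15) :
    Nat.card S = 60 := by
  by_cases hH : H = ⊥
  · have hn1 : Nat.card S ≠ 1 := fun h => by
      have := (Nat.card_eq_one_iff_unique.1 h).1
      exact hS inferInstance
    obtain ⟨p, hp, hpS⟩ := Nat.exists_prime_and_dvd hn1
    have : Fact p.Prime := ⟨hp⟩
    obtain ⟨x, hx⟩ := exists_prime_orderOf_dvd_card' p hpS
    have hx1 : Subgroup.zpowers x ≠ ⊥ := by
      rw [Ne, Subgroup.zpowers_eq_bot]
      rintro rfl
      exact hp.one_lt.ne (by simpa using hx)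
    refine card_eq_sixty_of_isCyclic_of_ne_bot hS hx1 (le_trans ?_ hm)
    rw [hH, Subgroup.index_bot]
    exact Nat.le_of_dvd Nat.card_pos (Subgroup.index_dvd_card _)
  · exact card_eq_sixty_of_isCyclic_of_ne_bot hS hH hm

theorem card_sylow_of_card_eq_sixty (hS : ¬ Group.IsSolvable S) (h60 : Nat.card S = 60) :
    Nat.card (Sylow 3 S) = 10 ∧ Nat.card (Sylow 5 S) = 6 := by
  have : Fact (Nat.Prime 3) := ⟨Nat.prime_three⟩
  have : Fact (Nat.Prime 5) := ⟨Nat.prime_five⟩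
  constructor
  · obtain ⟨_, h1, ⟨c, rfl⟩, h5, hmod⟩ := exists_card_sylow_mul hS 3 (by rw [h60]; norm_num)
    rw [h60] at h1
    have hc0 : c ≠ 0 := by rintro rfl; simp at h1
    have hc : c ≤ 4 := by nlinarith
    interval_cases c <;> omega
  · obtain ⟨_, h1, ⟨c, rfl⟩, h5, hmod⟩ := exists_card_sylow_mul hS 5 (by rw [h60]; norm_num)
    rw [h60] at h1
    have hc0 : c ≠ 0 := by rintro rfl; simp at h1
    have hc : c ≤ 2 := by nlinarith
    interval_cases c <;> omega

theorem orderOf_of_card_eq_sixty (hS : ¬ Group.IsSolvable S)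
    (h60 : Nat.card S = 60) {x : S} (hx : x ≠ 1) :
    orderOf x = 2 ∨ orderOf x = 3 ∨ orderOf x = 5 := by
  have : Fact (Nat.Prime 3) := ⟨Nat.prime_three⟩
  have : Fact (Nat.Prime 5) := ⟨Nat.prime_five⟩
  obtain ⟨hn3, hn5⟩ := card_sylow_of_card_eq_sixty hS h60
  have hx1 : orderOf x ≠ 1 := mt orderOf_eq_one_iff.1 hx
  have hdvd : orderOf x ∣ 60 := h60 ▸ orderOf_dvd_natCard x
  by_cases h3 : 3 ∣ orderOf x
  · obtain ⟨c, h1, h2, h2'⟩ := exists_card_sylow_mul_of_orderOf hS (p := 3)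
      (by rw [h60]; norm_num) h3
    rw [hn3, h60] at h1
    obtain rfl : c = 6 := by omega
    have := Nat.le_of_dvd (by norm_num) h2
    interval_cases orderOf x <;> omega
  by_cases h5 : 5 ∣ orderOf x
  · obtain ⟨c, h1, h2, h2'⟩ := exists_card_sylow_mul_of_orderOf hS (p := 5)
      (by rw [h60]; norm_num) h5
    rw [hn5, h60] at h1
    obtain rfl : c = 10 := by omega
    have := Nat.le_of_dvd (by norm_num) h2
    interval_cases orderOf x <;> omega
  have h20 : orderOf x ∣ 20 :=
    Nat.Coprime.dvd_of_dvd_mul_left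
      (Nat.Coprime.symm ((Nat.Prime.coprime_iff_not_dvd Nat.prime_three).2 h3))
      (hdvd.trans (by norm_num : 60 ∣ 3 * 20))
  have h4 : orderOf x ∣ 4 :=
    Nat.Coprime.dvd_of_dvd_mul_left
      (Nat.Coprime.symm ((Nat.Prime.coprime_iff_not_dvd Nat.prime_five).2 h5))
      (h20.trans (by norm_num : 20 ∣ 5 * 4))
  have h4' : orderOf x ≠ 4 := by
    intro h
    have hfac : (Nat.card S).factorization 2 = 2 := by
      have h1 := (Nat.prime_two.pow_dvd_iff_le_factorization (k := 2)
        (Nat.card_pos (α := S)).ne').1 (by rw [h60]; norm_num)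
      have h2 := mt (Nat.prime_two.pow_dvd_iff_le_factorization (k := 3)
        (Nat.card_pos (α := S)).ne').2 (by rw [h60]; norm_num)
      omega
    let P : Sylow 2 S := Sylow.ofCard (Subgroup.zpowers x) (by
      rw [Nat.card_zpowers, h, hfac]
      norm_num)
    have hP : (P : Subgroup S) = Subgroup.zpowers x := Sylow.coe_ofCard _ _
    have hcyc : IsCyclic P := by
      rw [hP]
      infer_instance
    exact not_normalizer_le_centralizer hS (by rw [h60]; norm_num) P
      (hcyc.normalizer_le_centralizer (by rw [h60]; norm_num))
  have := Nat.le_of_dvd (by norm_num) h4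
  interval_cases orderOf x <;> omega

theorem card_orderOf_of_card_eq_sixty (hS : ¬ Group.IsSolvable S) (h60 : Nat.card S = 60) :
    Nat.card {x : S // orderOf x = 2} = 15 ∧ Nat.card {x : S // orderOf x = 3} = 20 ∧
      Nat.card {x : S // orderOf x = 5} = 24 := by
  classical
  have := Fintype.ofFinite S
  have : Fact (Nat.Prime 3) := ⟨Nat.prime_three⟩
  have : Fact (Nat.Prime 5) := ⟨Nat.prime_five⟩
  obtain ⟨hn3, hn5⟩ := card_sylow_of_card_eq_sixty hS h60
  have h3 := card_orderOf_eq_prime_of_not_sq_dvd (G := S) (p := 3) (by rw [h60]; norm_num)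
    (by rw [h60]; norm_num)
  have h5 := card_orderOf_eq_prime_of_not_sq_dvd (G := S) (p := 5) (by rw [h60]; norm_num)
    (by rw [h60]; norm_num)
  rw [hn3] at h3
  rw [hn5] at h5
  refine ⟨?_, h3, h5⟩
  have hmaps : ∀ x ∈ (Finset.univ : Finset S), orderOf x ∈ ({1, 2, 3, 5} : Finset ℕ) := by
    intro x _
    by_cases hx : x = 1
    · simp [hx]
    · have := orderOf_of_card_eq_sixty hS h60 hx
      simp only [Finset.mem_insert, Finset.mem_singleton]
      omega
  have hsum := Finset.card_eq_sum_card_fiberwise hmaps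
  have h1 : (Finset.univ.filter fun x : S => orderOf x = 1).card = 1 :=
    Finset.card_eq_one.2 ⟨1, by ext; simp⟩
  rw [Finset.card_univ, ← Nat.card_eq_fintype_card, h60] at hsum
  rw [Nat.card_eq_fintype_card, Fintype.card_subtype] at h3 h5 ⊢
  simp only [Finset.mem_insert, OfNat.one_ne_ofNat, Finset.mem_singleton, or_self,
    not_false_eq_true, Finset.sum_insert, Nat.reduceEqDiff, Finset.sum_singleton, h1, h3, h5]
    at hsum
  omega

theorem card_and_index_of_isCyclic (hS : ¬ Group.IsSolvable S)
    {H : Subgroup S} [IsCyclic H] (hm : H.index ≤ 15) :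
    Nat.card S = 60 ∧ H.index = 12 := by
  have h60 := card_eq_sixty_of_isCyclic hS hm
  refine ⟨h60, ?_⟩
  obtain ⟨x, hx⟩ := IsCyclic.exists_generator (α := H)
  have hcx : Nat.card H = orderOf (x : S) := by
    rw [Subgroup.orderOf_coe, orderOf_eq_card_of_forall_mem_zpowers hx]
  have hcard := H.card_mul_index
  rw [h60, hcx] at hcard
  by_cases h1 : (x : S) = 1
  · rw [h1, orderOf_one] at hcard
    omega
  · rcases orderOf_of_card_eq_sixty hS h60 h1 with h | h | h <;> rw [h] at hcard <;> omega

end SimpleGroups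

theorem mul_comm_of_mem_isCyclic {G : Type*} [Group G] {H : Subgroup G} [IsCyclic H] {a b : G}
    (ha : a ∈ H) (hb : b ∈ H) : a * b = b * a :=
  congrArg Subtype.val (IsCyclic.isMulCommutative.is_comm.comm (⟨a, ha⟩ : H) ⟨b, hb⟩)

theorem eq_one_of_mem_center_of_normalCore_eq_bot {G : Type*} [Group G] {H : Subgroup G}
    (hcore : H.normalCore = ⊥) {b : G} (hb : b ∈ H) (hc : b ∈ Subgroup.center G) : b = 1 := by
  have : b ∈ H.normalCore := fun g => by
    rw [Subgroup.mem_center_iff.1 hc g, mul_inv_cancel_right]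
    exact hb
  simpa [hcore] using this

theorem le_of_card_eq_sixty {G : Type*} [Group G] [Finite G] (N H : Subgroup G) [N.Normal]
    [IsSimpleGroup N] [IsCyclic H] (hN : ¬ Group.IsSolvable N) (h60 : Nat.card N = 60)
    (h12 : H.relIndex N = 12) (hsup : H ⊔ N = ⊤) (hcore : H.normalCore = ⊥) : H ≤ N := by
  have : Fact (Nat.Prime 5) := ⟨Nat.prime_five⟩
  have hcard5 := card_sylow_eq_of_not_sq_dvd (G := N) (p := 5) (by rw [h60]; norm_num)
    (by rw [h60]; norm_num)
  have hX : Nat.card (Sylow 5 N) = 6 := (card_sylow_of_card_eq_sixty hN h60).2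
  let φ : G →* MulAut N := MulAut.conjNormal
  have hφN (n : N) (R : Sylow 5 N) : φ n • R = n • R := by
    rw [Sylow.smul_def]
    exact congrArg (· • R) (MulAut.conjNormal_val)
  have hPcard : Nat.card (H.subgroupOf N) = 5 := by
    have h := (H.subgroupOf N).card_mul_index
    change _ * H.relIndex N = _ at h
    rw [h12, h60] at h
    omega
  let P : Sylow 5 N := Sylow.ofCard (H.subgroupOf N) (by
    obtain ⟨R⟩ : Nonempty (Sylow 5 N) := inferInstance
    rw [hPcard, ← R.card_eq_multiplicity]
    exact (hcard5 R).symm)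
  have hP : (P : Subgroup N) = H.subgroupOf N := Sylow.coe_ofCard _ _
  have hPmem (u : N) : u ∈ P ↔ (u : G) ∈ H := by
    change u ∈ (P : Subgroup N) ↔ _
    rw [hP, Subgroup.mem_subgroupOf]
  have hfixP (a : G) (ha : a ∈ H) : φ a • P = P := by
    refine Sylow.ext (Subgroup.ext fun x => ?_)
    rw [Sylow.pointwise_smul_def, Subgroup.mem_pointwise_smul_iff_inv_smul_mem, ← map_inv]
    change MulAut.conjNormal a⁻¹ x ∈ P ↔ x ∈ P
    rw [hPmem, hPmem, MulAut.conjNormal_apply, inv_inv, Subgroup.mul_mem_cancel_right _ ha,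
      Subgroup.mul_mem_cancel_left _ (H.inv_mem ha)]
  obtain ⟨Q, hQ⟩ : ∃ Q : Sylow 5 N, Q ≠ P := by
    have : Nontrivial (Sylow 5 N) := Finite.one_lt_card_iff_nontrivial.1 (by omega)
    exact exists_ne P
  let F : P → {R : Sylow 5 N // R ≠ P} := fun u => ⟨(u : N) • Q, fun h => hQ (by
    have h' := hfixP _ ((hPmem u).1 u.2)
    rw [hφN] at h'
    exact MulAction.injective (u : N) (h.trans h'.symm))⟩
  have hF : Function.Bijective F := by
    have hinf : (P : Subgroup N) ⊓ Q = ⊥ := by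
      have hdvd : Nat.card ((P : Subgroup N) ⊓ Q : Subgroup N) ∣ 5 :=
        (Subgroup.card_dvd_of_le inf_le_left).trans (hcard5 P).dvd
      rcases (Nat.dvd_prime Nat.prime_five).1 hdvd with h | h
      · exact Subgroup.card_eq_one.1 h
      · refine absurd (Sylow.ext ?_) hQ
        rw [← Subgroup.eq_of_le_of_card_ge inf_le_left (h.trans (hcard5 P).symm).ge]
        exact (Subgroup.eq_of_le_of_card_ge inf_le_right (h.trans (hcard5 Q).symm).ge).symm
    have hinj : Function.Injective F := by
      intro u v huv
      have h : (u : N) • Q = (v : N) • Q := congrArg Subtype.val huv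
      have h' : ((v : N)⁻¹ * u) • Q = Q := by rw [mul_smul, h, inv_smul_smul]
      have hmem : (v : N)⁻¹ * u ∈ (P : Subgroup N) ⊓ Subgroup.normalizer (Q : Set N) :=
        ⟨P.mul_mem (P.inv_mem v.2) u.2, Sylow.smul_eq_iff_mem_normalizer.1 h'⟩
      rw [P.isPGroup'.inf_normalizer_sylow, hinf, Subgroup.mem_bot, inv_mul_eq_one] at hmem
      exact Subtype.ext hmem.symm
    refine hinj.bijective_of_nat_card_le ?_
    have := Fintype.ofFinite (Sylow 5 N)
    classical
    rw [Nat.card_eq_fintype_card, Fintype.card_subtype_compl, Fintype.card_subtype_eq,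
      ← Nat.card_eq_fintype_card, hX]
    exact (hcard5 P).ge
  have hker {b : G} (hb : b ∈ H) (hbQ : φ b • Q = Q) : b = 1 := by
    have hfix (R : Sylow 5 N) : φ b • R = R := by
      by_cases hR : R = P
      · rw [hR, hfixP b hb]
      obtain ⟨u, hu⟩ := hF.2 ⟨R, hR⟩
      have hu' : (u : N) • Q = R := congrArg Subtype.val hu
      rw [← hu', ← hφN, ← mul_smul, ← map_mul, mul_comm_of_mem_isCyclic hb ((hPmem u).1 u.2),
        map_mul, mul_smul, hbQ]
    have hcentN (n : N) : b * n * b⁻¹ = n := by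
      have hK : (MulAction.toPermHom N (Sylow 5 N)).ker = ⊥ := by
        refine (Subgroup.Normal.eq_bot_or_eq_top (MonoidHom.normal_ker _)).resolve_right
          fun h => normalizer_sylow_ne_top hN (p := 5) (by rw [h60]; norm_num) P ?_
        refine top_le_iff.1 fun x _ => Sylow.smul_eq_iff_mem_normalizer.1 ?_
        have hx : x ∈ (MulAction.toPermHom N (Sylow 5 N)).ker := h ▸ Subgroup.mem_top x
        exact congrArg (fun σ : Equiv.Perm (Sylow 5 N) => σ P) (MonoidHom.mem_ker.1 hx)
      let m : N := MulAut.conjNormal b n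
      have hm : (m : G) = b * n * b⁻¹ := MulAut.conjNormal_apply b n
      have hmR (R : Sylow 5 N) : m • R = n • R := by
        rw [← hφN, hm, map_mul, map_mul, mul_smul, mul_smul, hφN, hfix, map_inv,
          inv_smul_eq_iff.2 (hfix R).symm]
      have hmn : m⁻¹ * n ∈ (MulAction.toPermHom N (Sylow 5 N)).ker := by
        rw [MonoidHom.mem_ker]
        ext1 R
        rw [MulAction.toPermHom_apply, MulAction.toPerm_apply, mul_smul, ← hmR, inv_smul_smul]
        rfl
      rw [hK, Subgroup.mem_bot, inv_mul_eq_one] at hmn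
      rw [← hm, hmn]
    refine eq_one_of_mem_center_of_normalCore_eq_bot hcore hb ?_
    have hle : H ⊔ N ≤ Subgroup.centralizer {b} := by
      refine sup_le (fun x hx => ?_) (fun x hx => ?_)
      · rw [Subgroup.mem_centralizer_singleton_iff]
        exact mul_comm_of_mem_isCyclic hx hb
      · rw [Subgroup.mem_centralizer_singleton_iff]
        exact (mul_inv_eq_iff_eq_mul.1 (hcentN ⟨x, hx⟩)).symm
    rw [Subgroup.mem_center_iff]
    intro g
    exact Subgroup.mem_centralizer_singleton_iff.1 (hle (hsup ▸ Subgroup.mem_top g))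
  intro a ha
  have haQ : φ a • Q ≠ P := fun h => hQ (MulAction.injective (φ a) (h.trans (hfixP a ha).symm))
  obtain ⟨u, hu⟩ := hF.2 ⟨_, haQ⟩
  have hu' : (u : N) • Q = φ a • Q := congrArg Subtype.val hu
  have huH := (hPmem u).1 u.2
  have h1 := hker (H.mul_mem (H.inv_mem huH) ha) (by
    rw [map_mul, mul_smul, ← hu', ← hφN, ← mul_smul, ← map_mul, inv_mul_cancel, map_one, one_smul])
  rw [inv_mul_eq_one] at h1
  exact h1 ▸ (u : N).2

theorem card_quotient_lt_of_ne_bot {G : Type*} [Group G] [Finite G] {K : Subgroup G}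
    (hK : K ≠ ⊥) : Nat.card (G ⧸ K) < Nat.card G := by
  rw [K.card_eq_card_quotient_mul_card_subgroup]
  exact lt_mul_of_one_lt_right Nat.card_pos ((Subgroup.one_lt_card_iff_ne_bot _).2 hK)

theorem isCyclic_map {G G' : Type*} [Group G] [Group G'] (f : G →* G') (H : Subgroup G)
    [IsCyclic H] : IsCyclic (H.map f) :=
  isCyclic_of_surjective (f.subgroupMap H) (f.subgroupMap_surjective H)

theorem isCyclic_subgroupOf {G : Type*} [Group G] (H N : Subgroup G) [IsCyclic H] :
    IsCyclic (H.subgroupOf N) :=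
  isCyclic_of_injective (N.subtype.subgroupComap H)
    fun _ _ h => Subtype.ext (Subtype.ext (congrArg (fun x : H => (x : G)) h))

theorem relIndex_mul_index_sup {G : Type*} [Group G] [Finite G] (H N : Subgroup G) [N.Normal] :
    H.relIndex N * (H ⊔ N).index = H.index := by
  have h1 := Subgroup.relIndex_mul_index (inf_le_right : H ⊓ N ≤ N)
  have h2 := Subgroup.relIndex_mul_index (inf_le_left : H ⊓ N ≤ H)
  have h3 := Subgroup.relIndex_mul_index (le_sup_right : N ≤ H ⊔ N)
  rw [Subgroup.inf_relIndex_right] at h1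
  rw [Subgroup.inf_relIndex_left] at h2
  rw [Subgroup.relIndex_sup_right] at h3
  have hpos : 0 < N.relIndex H := Nat.pos_of_ne_zero Subgroup.index_ne_zero_of_finite
  refine Nat.eq_of_mul_eq_mul_left hpos ?_
  rw [h2, ← h1, ← h3]
  ring

theorem exists_surjective_simple_of_isCyclic.{u} {G : Type u} [Group G] [Finite G]
    (hG : ¬ Group.IsSolvable G) {H : Subgroup G} [IsCyclic H] (hm : H.index ≤ 15) :
    H.index = 12 ∧ ∃ (S : Type u) (_ : Group S) (f : G →* S), Function.Surjective f ∧
      f.ker ≤ H ∧ IsSimpleGroup S ∧ Nat.card S = 60 ∧ ¬ Group.IsSolvable S := by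
  induction hn : Nat.card G using Nat.strong_induction_on generalizing G with
  | _ n ih =>
  subst hn
  have hHS : Group.IsSolvable H :=
    Group.isSolvable_of_comm fun a b => Subtype.ext (mul_comm_of_mem_isCyclic a.2 b.2)
  by_cases hcore : H.normalCore = ⊥
  swap
  · have hle := H.normalCore_le
    have hker : (QuotientGroup.mk' H.normalCore).ker ≤ H := by rwa [QuotientGroup.ker_mk']
    have hidx := H.index_map_eq (QuotientGroup.mk'_surjective H.normalCore) hker
    have := isCyclic_map (QuotientGroup.mk' H.normalCore) H
    have hKS : Group.IsSolvable H.normalCore :=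
      Group.isSolvable_of_isSolvable_injective (Subgroup.inclusion_injective hle)
    obtain ⟨h12, S, _, f, hf, hfk, hS⟩ := ih _ (card_quotient_lt_of_ne_bot hcore)
      (fun h => hG ((Group.isSolvable_iff_subgroup_quotient H.normalCore).2 ⟨hKS, h⟩))
      (H := H.map (QuotientGroup.mk' H.normalCore)) (hidx.trans_le hm) rfl
    refine ⟨hidx ▸ h12, S, _, f.comp (QuotientGroup.mk' _),
      hf.comp (QuotientGroup.mk'_surjective _), fun x hx => ?_, hS⟩
    obtain ⟨y, hy, hyx⟩ := hfk (show QuotientGroup.mk' H.normalCore x ∈ f.ker from hx)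
    have h1 : y⁻¹ * x ∈ (QuotientGroup.mk' H.normalCore).ker := by
      rw [MonoidHom.mem_ker, map_mul, map_inv, hyx, inv_mul_cancel]
    simpa using H.mul_mem hy (hker h1)
  by_cases hs : IsSimpleGroup G
  · obtain ⟨h60, h12⟩ := card_and_index_of_isCyclic hG hm
    exact ⟨h12, G, _, MonoidHom.id G, Function.surjective_id, by simp [MonoidHom.ker_id], hs,
      h60, hG⟩
  exfalso
  have hnt : Nontrivial G := by
    by_contra h
    rw [not_nontrivial_iff_subsingleton] at h
    exact hG inferInstance
  obtain ⟨N, hN, hN1, hN2⟩ : ∃ N : Subgroup G, N.Normal ∧ N ≠ ⊥ ∧ N ≠ ⊤ := by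
    by_contra! h
    exact hs ⟨fun N hN => or_iff_not_imp_left.2 (h N hN)⟩
  have hidx : H.relIndex N * (H ⊔ N).index = H.index := relIndex_mul_index_sup H N
  have hpos : 0 < H.index := Nat.pos_of_ne_zero Subgroup.index_ne_zero_of_finite
  by_cases hNS : Group.IsSolvable N
  · have := isCyclic_map (QuotientGroup.mk' N) H
    have hmap : (H.map (QuotientGroup.mk' N)).index = (H ⊔ N).index := by
      rw [Subgroup.index_map, QuotientGroup.ker_mk', MonoidHom.range_eq_top.2
        (QuotientGroup.mk'_surjective N), Subgroup.index_top, mul_one]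
    have hle := Nat.le_of_dvd hpos (Dvd.intro_left _ hidx)
    obtain ⟨h12, -⟩ := ih _ (card_quotient_lt_of_ne_bot hN1)
      (fun h => hG ((Group.isSolvable_iff_subgroup_quotient N).2 ⟨hNS, h⟩))
      (H := H.map (QuotientGroup.mk' N)) (by omega) rfl
    rw [← hmap, h12] at hidx
    have h1 : H.relIndex N = 1 := by omega
    have h2 := Subgroup.normal_le_normalCore.2 (Subgroup.relIndex_eq_one.1 h1)
    exact hN1 (le_bot_iff.1 (hcore ▸ h2))
  · have := isCyclic_subgroupOf H N
    have hlt : Nat.card N < Nat.card G := by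
      refine lt_of_le_of_ne (Subgroup.card_le_card_group N) fun h => hN2 ?_
      exact Subgroup.eq_top_of_card_eq N h
    have hle := Nat.le_of_dvd hpos (Dvd.intro _ hidx)
    obtain ⟨h12, S, _, f, hf, hfk, hS, h60, hSS⟩ := ih _ hlt hNS (H := H.subgroupOf N)
      (hle.trans hm) rfl
    change H.relIndex N = 12 at h12
    have h1 : (H ⊔ N).index = 1 := by
      rw [h12] at hidx
      omega
    have hsup := Subgroup.index_eq_one.1 h1
    have hKH : f.ker.map N.subtype ≤ H := by
      rw [Subgroup.map_le_iff_le_comap]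
      exact hfk
    have hKN : (f.ker.map N.subtype).Normal := by
      rw [← Subgroup.normalizer_eq_top_iff, ← top_le_iff, ← hsup, sup_le_iff]
      constructor
      · intro a ha
        rw [Subgroup.mem_normalizer_iff]
        intro h
        have hcomm (hh : h ∈ H) : a * h * a⁻¹ = h := by
          rw [mul_comm_of_mem_isCyclic ha hh, mul_inv_cancel_right]
        constructor
        · intro hh
          rwa [hcomm (hKH hh)]
        · intro hh
          have h3 := hKH hh
          rw [Subgroup.mul_mem_cancel_right _ (H.inv_mem ha),
            Subgroup.mul_mem_cancel_left _ ha] at h3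
          rwa [hcomm h3] at hh
      · have h := Subgroup.le_normalizer_map (H := f.ker) N.subtype
        rw [Subgroup.normalizer_eq_top, ← MonoidHom.range_eq_map, Subgroup.range_subtype] at h
        exact h
    have hK : f.ker = ⊥ := by
      have h2 := Subgroup.normal_le_normalCore.2 hKH
      rw [hcore, le_bot_iff, Subgroup.map_eq_bot_iff_of_injective _ N.subtype_injective] at h2
      exact h2
    let e : N ≃* S := MulEquiv.ofBijective f ⟨(MonoidHom.ker_eq_bot_iff f).1 hK, hf⟩
    have := e.isSimpleGroup
    have hHN := le_of_card_eq_sixty N H hNS ((Nat.card_congr e.toEquiv).trans h60) h12 hsup hcore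
    exact hN2 (by rwa [sup_eq_right.2 hHN] at hsup)

theorem ker_le_center_of_isCyclic {G S : Type*} [Group G] [Group S] [IsSimpleGroup S]
    (hS : ¬ Group.IsSolvable S) (f : G →* S) (hf : Function.Surjective f) [IsCyclic f.ker] :
    f.ker ≤ Subgroup.center G := by
  let C := Subgroup.centralizer (f.ker : Set G)
  have hKC : f.ker ≤ C := fun a ha =>
    Subgroup.mem_centralizer_iff.2 fun b hb => mul_comm_of_mem_isCyclic hb ha
  have hcomm (a b : G) : a⁻¹ * b⁻¹ * (a * b) ∈ C := by
    have h : MulAut.conjNormal (H := f.ker) (a⁻¹ * b⁻¹ * (a * b)) = 1 := by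
      refine (IsCyclic.mulAutMulEquiv f.ker).injective ?_
      simp only [map_mul, map_inv, map_one]
      rw [← mul_inv, inv_mul_cancel]
    refine Subgroup.mem_centralizer_iff.2 fun c hc => ?_
    have h1 := congrArg Subtype.val (DFunLike.congr_fun h ⟨c, hc⟩)
    rw [MulAut.conjNormal_apply, mul_inv_eq_iff_eq_mul] at h1
    exact h1.symm
  have hmap : C.map f = ⊤ := by
    refine (Subgroup.Normal.eq_bot_or_eq_top (Subgroup.Normal.map inferInstance f hf)).resolve_left
      fun h => hS (Group.isSolvable_of_comm fun s t => ?_)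
    obtain ⟨a, rfl⟩ := hf s
    obtain ⟨b, rfl⟩ := hf t
    have h1 : f (b⁻¹ * a⁻¹ * (b * a)) ∈ C.map f := Subgroup.mem_map_of_mem f (hcomm b a)
    rw [h, Subgroup.mem_bot, ← mul_inv_rev, map_mul, map_inv, inv_mul_eq_one, map_mul,
      map_mul] at h1
    exact h1
  have hC : C = ⊤ := by
    rw [← Subgroup.comap_map_eq_self hKC, hmap, Subgroup.comap_top]
  intro a ha
  refine Subgroup.mem_center_iff.2 fun g => ?_
  exact (Subgroup.mem_centralizer_iff.1 (hC ▸ Subgroup.mem_top g : g ∈ C) a ha).symm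

theorem exists_sylow_le_zpowers {G : Type*} [Group G] [Finite G] {q : ℕ} [Fact q.Prime] {x : G}
    (h : ¬ q ∣ (Subgroup.zpowers x).index) : ∃ Q : Sylow q G, (Q : Subgroup G) ≤ .zpowers x := by
  have hn := (Subgroup.zpowers x).card_mul_index
  rw [Nat.card_zpowers] at hn
  have hfac : (Nat.card G).factorization q = (orderOf x).factorization q := by
    rw [← hn, Nat.factorization_mul (orderOf_pos x).ne' Subgroup.index_ne_zero_of_finite,
      Finsupp.add_apply, Nat.factorization_eq_zero_of_not_dvd h, add_zero]
  have hord : orderOf (x ^ (orderOf x / q ^ (orderOf x).factorization q)) =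
      q ^ (orderOf x).factorization q := by
    rw [orderOf_pow_of_dvd (Nat.ordCompl_pos q (orderOf_pos x).ne').ne'
      (Nat.ordCompl_dvd _ _), Nat.div_div_self (Nat.ordProj_dvd _ _) (orderOf_pos x).ne']
  refine ⟨Sylow.ofCard (.zpowers (x ^ (orderOf x / q ^ (orderOf x).factorization q))) ?_, ?_⟩
  · rw [Nat.card_zpowers, hord, hfac]
  · rw [Sylow.coe_ofCard, Subgroup.zpowers_le]
    exact Subgroup.npow_mem_zpowers x _

theorem prime_le_index_zpowers {G : Type*} [Group G] [Finite G]
    (hG : ∀ q : ℕ, q.Prime → q ∣ Nat.card G → ∀ Q : Sylow q G, IsCyclic Q →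
      ¬ (Q : Subgroup G).Normal) (x : G) {q : ℕ} (hq : q.Prime) (hqG : q ∣ Nat.card G) :
    q ≤ (Subgroup.zpowers x).index ∧ ((Subgroup.zpowers x).index = 16 → q ≤ 7) := by
  have hpos : 0 < (Subgroup.zpowers x).index := Nat.pos_of_ne_zero Subgroup.index_ne_zero_of_finite
  by_cases h : q ∣ (Subgroup.zpowers x).index
  · refine ⟨Nat.le_of_dvd hpos h, fun h16 => ?_⟩
    rw [h16] at h
    have := (Nat.prime_dvd_prime_iff_eq hq Nat.prime_two).1
      (hq.dvd_of_dvd_pow (show q ∣ 2 ^ 4 from h))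
    omega
  · have : Fact q.Prime := ⟨hq⟩
    obtain ⟨Q, hQ⟩ := exists_sylow_le_zpowers h
    have hcyc : IsCyclic (Q : Subgroup G) := Subgroup.isCyclic_of_le hQ
    have hnorm : Subgroup.zpowers x ≤ Subgroup.normalizer (Q : Set G) := by
      have : ((Q : Subgroup G).subgroupOf (.zpowers x)).Normal :=
        ⟨fun b hb a => by
          have hab : a * b = b * a := Subtype.ext (mul_comm_of_mem_isCyclic a.2 b.2)
          rwa [hab, mul_inv_cancel_right]⟩
      exact Subgroup.normal_subgroupOf_iff_le_normalizer hQ |>.1 this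
    have hdvd := Subgroup.index_dvd_of_le hnorm
    rw [← Q.card_eq_index_normalizer] at hdvd
    have hmod := card_sylow_modEq_one q G
    have hne : Nat.card (Sylow q G) ≠ 1 := by
      intro h1
      rw [Q.card_eq_index_normalizer, Subgroup.index_eq_one] at h1
      exact hG q hq hqG Q hcyc (Subgroup.normalizer_eq_top_iff.1 h1)
    have hpos' : 0 < Nat.card (Sylow q G) := Nat.card_pos
    have hsub : q ∣ Nat.card (Sylow q G) - 1 := (Nat.modEq_iff_dvd' hpos').1 hmod.symm
    have hle := Nat.le_of_dvd (by omega) hsub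
    have hle' := Nat.le_of_dvd hpos hdvd
    refine ⟨by omega, fun h16 => ?_⟩
    rw [h16] at hdvd
    obtain ⟨j, hj, hj'⟩ := (Nat.dvd_prime_pow Nat.prime_two).1 (show _ ∣ 2 ^ 4 from hdvd)
    rw [hj'] at hsub hne
    have hq2 := hq.two_le
    interval_cases j
    · omega
    · exact (Nat.le_of_dvd (by norm_num) hsub).trans (by norm_num)
    · exact (Nat.le_of_dvd (by norm_num) hsub).trans (by norm_num)
    · exact (Nat.le_of_dvd (by norm_num) hsub).trans (by norm_num)
    · rcases hq.dvd_mul.1 (show q ∣ 3 * 5 from hsub) with h | h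
      · exact (Nat.le_of_dvd (by norm_num) h).trans (by norm_num)
      · exact (Nat.le_of_dvd (by norm_num) h).trans (by norm_num)

theorem psi_le_psiRatio_mul_of_index {G : Type*} [Group G] [Fintype G]
    (hG : ∀ q : ℕ, q.Prime → q ∣ Nat.card G → ∀ Q : Sylow q G, IsCyclic Q →
      ¬ (Q : Subgroup G).Normal)
    (hidx : ∀ x : G, 16 ≤ (Subgroup.zpowers x).index) {k : ℕ} (hk : 4 ≤ k) :
    (psi G k : ℚ) ≤ psiRatio k * cyclicPsi k (Nat.card G) := by
  obtain ⟨x, -, hx⟩ := Finset.exists_max_image Finset.univ (fun g : G => orderOf g)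
    Finset.univ_nonempty
  have hn := (Subgroup.zpowers x).card_mul_index
  rw [Nat.card_zpowers] at hn
  have h16 := hidx x
  have hprime (q : ℕ) (hq : q.Prime) (hqG : q ∣ Nat.card G) := prime_le_index_zpowers hG x hq hqG
  set m := (Subgroup.zpowers x).index
  have hsum : psi G k * m ^ k ≤ Nat.card G * Nat.card G ^ k := by
    calc psi G k * m ^ k ≤ (∑ _g : G, orderOf x ^ k) * m ^ k := by
          refine Nat.mul_le_mul_right _ (Finset.sum_le_sum fun g hg => ?_)
          exact Nat.pow_le_pow_left (hx g hg) k
      _ = Nat.card G * Nat.card G ^ k := by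
          rw [Finset.sum_const, Finset.card_univ, smul_eq_mul, mul_assoc, ← mul_pow, hn,
            Nat.card_eq_fintype_card]
  have hbound := pow_le_psiRatio_mul_cyclicPsi (k := k) (n := Nat.card G) (m := m) hk
    Nat.card_pos.ne' (by
      rcases h16.lt_or_eq with h | h
      · exact Or.inl ⟨h, fun q hq hqG => (hprime q hq hqG).1⟩
      · exact Or.inr ⟨h.symm, fun q hq hqG => (hprime q hq hqG).2 h.symm⟩)
  have hmpos : (0 : ℚ) < (m : ℚ) ^ k := by
    have : 0 < m := by omega
    positivity
  refine le_of_mul_le_mul_right (le_trans ?_ hbound) hmpos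
  exact_mod_cast hsum

theorem psi_le_psiRatio_mul.{u} {G : Type u} [Group G] [Fintype G] (hG : ¬ Group.IsSolvable G)
    {k : ℕ} (hk : 4 ≤ k) : (psi G k : ℚ) ≤ psiRatio k * cyclicPsi k (Nat.card G) := by
  induction hn : Nat.card G using Nat.strong_induction_on generalizing G with
  | _ n ih =>
  subst hn
  by_cases hsyl : ∀ q : ℕ, q.Prime → q ∣ Nat.card G → ∀ Q : Sylow q G, IsCyclic Q →
      ¬ (Q : Subgroup G).Normal
  · by_cases hidx : ∀ x : G, 16 ≤ (Subgroup.zpowers x).index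
    · exact psi_le_psiRatio_mul_of_index hsyl hidx hk
    push Not at hidx
    obtain ⟨x, hx⟩ := hidx
    obtain ⟨-, S, _, f, hf, hfx, _, h60, hS⟩ :=
      exists_surjective_simple_of_isCyclic hG (Nat.le_of_lt_succ hx)
    have hcyc := Subgroup.isCyclic_of_le hfx
    have := Finite.of_surjective f hf
    have := Fintype.ofFinite S
    obtain ⟨h2, h3, h5⟩ := card_orderOf_of_card_eq_sixty hS h60
    exact psi_central_extension f hf hcyc (ker_le_center_of_isCyclic hS f hf)
      (fun s hs => orderOf_of_card_eq_sixty hS h60 hs) h2 h3 h5 h60 k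
  · push Not at hsyl
    obtain ⟨q, hq, hqG, P, hP, hPn⟩ := hsyl
    have : Fact q.Prime := ⟨hq⟩
    have hcop : (Nat.card P).Coprime (P : Subgroup G).index := P.card_coprime_index
    obtain ⟨C, hC⟩ := Subgroup.exists_right_complement'_of_coprime hcop
    have hcard := hC.card_mul_card
    have hCidx : (P : Subgroup G).index = Nat.card C := hC.symm.index_eq_card
    have hPS : Group.IsSolvable P :=
      Group.isSolvable_of_comm fun a b => Subtype.ext (mul_comm_of_mem_isCyclic a.2 b.2)
    have hCS : ¬ Group.IsSolvable C := fun h =>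
      hG ((Group.isSolvable_iff_subgroup_quotient (P : Subgroup G)).2 ⟨hPS,
        Group.isSolvable_of_isSolvable_injective (f := hC.symm.QuotientMulEquiv.toMonoidHom)
          hC.symm.QuotientMulEquiv.injective⟩)
    have hP1 : 1 < Nat.card P :=
      hq.one_lt.trans_le (Nat.le_of_dvd Nat.card_pos (P.dvd_card_of_dvd_card hqG))
    have := Fintype.ofFinite P
    have := Fintype.ofFinite C
    have hlt : Nat.card C < Nat.card G := by
      rw [← hcard]
      exact lt_mul_of_one_lt_left Nat.card_pos hP1
    have hIH := ih _ hlt hCS rfl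
    rw [← hcard, cyclicPsi_mul_of_coprime k (hCidx ▸ hcop), ← psi_eq_cyclicPsi]
    calc (psi G k : ℚ) ≤ psi P k * psi C k := by
          exact_mod_cast psi_le_mul_of_isComplement' (P : Subgroup G) C hC k
      _ ≤ psi P k * (psiRatio k * cyclicPsi k (Nat.card C)) := by gcongr
      _ = _ := by push_cast; ring

theorem solvable_of_psi_gt_of_largest_prime_gt_seven
    (G : Type*) [Group G] [Fintype G] (n : ℕ) [NeZero n] (hn : Fintype.card G = n)
    (p : ℕ) (hp : p.Prime) (hpn : p ∣ n) (hmax : ∀ q : ℕ, q.Prime → q ∣ n → q ≤ p)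
    (hp7 : 7 < p) (k : ℕ) (hk : 4 ≤ k)
    (h : (psi G k : ℚ) >
        ((1 + 15 * 2 ^ k + 20 * 3 ^ k + 24 * 5 ^ k : ℚ) /
          ((1 + 2 ^ k + 2 * 4 ^ k) * (1 + 2 * 3 ^ k) * (1 + 4 * 5 ^ k))) *
        (psi (Multiplicative (ZMod n)) k : ℚ)) :
    IsSolvable G := by
  by_contra hG
  refine absurd h (not_lt.2 ?_)
  have : IsCyclic (Multiplicative (ZMod n)) := isCyclic_multiplicative
  rw [psi_eq_cyclicPsi (Multiplicative (ZMod n)), Nat.card_eq_fintype_card,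
    Fintype.card_multiplicative, ZMod.card, ← hn, ← Nat.card_eq_fintype_card]
  exact psi_le_psiRatio_mul hG hk
end

section
/- Let G be a finite group of order n and let q be the smallest prime divisor of n. If there exists a positive integer k such that ψ_k(G) ≥ (3·n^k / (5·q^{k-1})) · φ(n), then G is solvable. -/
theorem isSolvable_perm_of_card_le_three {α : Type*} [Finite α] (h : Nat.card α ≤ 3) :
    Group.IsSolvable (Equiv.Perm α) := by
  have : Squarefree (Nat.card (Equiv.Perm α)) := by
    rw [Nat.card_perm]
    interval_cases Nat.card α <;> decide +kernel
  have := IsZGroup.of_squarefree this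
  infer_instance

theorem isSolvable_of_perm_quotient {G : Type*} [Group G] (H : Subgroup G) [Group.IsSolvable H]
    [Group.IsSolvable (Equiv.Perm (G ⧸ H))] : Group.IsSolvable G := by
  refine Group.isSolvable_of_ker_le_range H.subtype (MulAction.toPermHom G (G ⧸ H)) ?_
  rw [← Subgroup.normalCore_eq_ker, Subgroup.range_subtype]
  exact H.normalCore_le

theorem isSolvable_of_index_le_three {G : Type*} [Group G] [Finite G] (H : Subgroup G)
    [Group.IsSolvable H] (h : H.index ≤ 3) : Group.IsSolvable G := by
  have := isSolvable_perm_of_card_le_three (α := G ⧸ H) h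
  exact isSolvable_of_perm_quotient H

theorem isSolvable_perm_of_card_le_four {α : Type*} [Finite α] (h : Nat.card α ≤ 4) :
    Group.IsSolvable (Equiv.Perm α) := by
  rcases Nat.lt_or_ge (Nat.card α) 4 with h4 | h4
  · exact isSolvable_perm_of_card_le_three (by omega)
  have hc : Nat.card (Equiv.Perm α) = 24 := by
    rw [Nat.card_perm, le_antisymm h h4]; rfl
  obtain ⟨P, hP⟩ := Sylow.exists_subgroup_card_pow_prime (G := Equiv.Perm α) 2 (n := 3)
    (by rw [hc]; norm_num)
  have := (IsPGroup.of_card hP).isNilpotent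
  have hm := P.card_mul_index
  rw [hc, hP] at hm
  exact isSolvable_of_index_le_three P (by omega)

theorem isSolvable_of_index_le_four {G : Type*} [Group G] [Finite G] (H : Subgroup G)
    [Group.IsSolvable H] (h : H.index ≤ 4) : Group.IsSolvable G := by
  have := isSolvable_perm_of_card_le_four (α := G ⧸ H) h
  exact isSolvable_of_perm_quotient H

theorem isSolvable_of_isCyclic {G : Type*} [Group G] [IsCyclic G] : Group.IsSolvable G :=
  Group.isSolvable_of_comm IsMulCommutative.is_comm.comm

theorem isSolvable_of_isZGroup {G : Type*} [Group G] [Finite G] [IsZGroup G] :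
    Group.IsSolvable G :=
  inferInstance

/-- A finite group with a cyclic subgroup of coprime squarefree index is a Z-group. -/
theorem IsZGroup.of_cyclic_coprime_squarefree_index {G : Type*} [Group G] [Finite G]
    (A : Subgroup G) [IsCyclic A] (hsq : Squarefree A.index)
    (hco : (Nat.card A).Coprime A.index) : IsZGroup G := by
  refine ⟨fun r hr P ↦ ?_⟩
  have := Fact.mk hr
  obtain ⟨k, hk⟩ := P.2.exists_card_eq
  have hdvd : r ^ k ∣ Nat.card A * A.index := by
    rw [A.card_mul_index, ← hk]; exact P.card_subgroup_dvd_card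
  by_cases hrd : r ∣ A.index
  · have hra : (r ^ k).Coprime (Nat.card A) :=
      (Nat.Coprime.coprime_dvd_right hrd hco).symm.pow_left k
    refine isCyclic_of_card_dvd_prime (p := r) ?_
    rw [hk]
    exact hsq.pow_dvd_of_pow_dvd (hra.dvd_of_dvd_mul_left hdvd)
  · have hra : (r ^ k).Coprime A.index := ((Nat.Prime.coprime_iff_not_dvd hr).2 hrd).pow_left k
    obtain ⟨K, hK⟩ := Sylow.exists_subgroup_card_pow_prime r (hra.dvd_of_dvd_mul_right hdvd)
    have hKc : Nat.card (K.map A.subtype) = Nat.card P := by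
      rw [Subgroup.card_map_of_injective A.subtype_injective, hK, hk]
    have hcyc : IsCyclic (K.map A.subtype) := Subgroup.isCyclic_of_le (Subgroup.map_subtype_le K)
    let Q : Sylow r G := Sylow.ofCard (K.map A.subtype) (by rw [hKc, P.card_eq_multiplicity])
    have : IsCyclic Q := hcyc
    exact isCyclic_of_surjective (Q.equiv P) (Q.equiv P).surjective

theorem le_normalizer_of_le_isCyclic {G : Type*} [Group G] {A K : Subgroup G} [IsCyclic A]
    (h : K ≤ A) : A ≤ Subgroup.normalizer (K : Set G) :=
  le_trans (fun a ha ↦ Subgroup.mem_centralizer_iff.2 fun b hb ↦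
    congrArg Subtype.val (IsMulCommutative.is_comm.comm (⟨b, h hb⟩ : A) ⟨a, ha⟩))
    (Subgroup.centralizer_le_normalizer _)

/-- If a maximal cyclic subgroup `A` has index divisible by a prime divisor `r` of its order,
then the Sylow `r`-subgroup of `A` is normal in the whole group. -/
theorem exists_normal_le_of_isCoatom {G : Type*} [Group G] [Finite G] (A : Subgroup G) [IsCyclic A]
    (hA : IsCoatom A) {r : ℕ} (hr : r.Prime) (hra : r ∣ Nat.card A) (hrd : r ∣ A.index) :
    ∃ R : Subgroup G, R.Normal ∧ R ≠ ⊥ ∧ R ≤ A := by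
  have := Fact.mk hr
  obtain ⟨R⟩ : Nonempty (Sylow r A) := inferInstance
  have hcard := R.card_eq_multiplicity
  have hRc : Nat.card ((R : Subgroup A).map A.subtype) = r ^ (Nat.card A).factorization r := by
    rw [Subgroup.card_map_of_injective A.subtype_injective, ← hcard]
  have hRA : (R : Subgroup A).map A.subtype ≤ A := Subgroup.map_subtype_le _
  have hAN : A ≤ Subgroup.normalizer (((R : Subgroup A).map A.subtype : Subgroup G) : Set G) :=
    le_normalizer_of_le_isCyclic hRA
  have hdvd : r ^ ((Nat.card A).factorization r + 1) ∣ Nat.card G := by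
    rw [pow_succ, ← A.card_mul_index]
    exact mul_dvd_mul (Nat.ordProj_dvd _ _) hrd
  have hN := Sylow.prime_pow_dvd_card_normalizer hdvd hRc
  refine ⟨(R : Subgroup A).map A.subtype, ?_, ?_, hRA⟩
  · rw [← Subgroup.normalizer_eq_top_iff]
    rcases hA.le_iff.1 hAN with h | h
    · exact h
    · rw [h] at hN
      exact absurd hN (Nat.pow_succ_factorization_not_dvd Nat.card_pos.ne' hr)
  · rw [Ne, Subgroup.map_eq_bot_iff_of_injective _ A.subtype_injective]
    exact R.ne_bot_of_dvd_card hra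

theorem isSolvable_of_cyclic_index_le_seven (m : ℕ) : ∀ {G : Type*} [Group G] [Finite G]
    (A : Subgroup G) [IsCyclic A], Nat.card G ≤ m → A.index ≤ 7 → Group.IsSolvable G := by
  induction m with
  | zero => intro G _ _ A _ hm; exact absurd hm (by simpa using Nat.card_pos (α := G).ne')
  | succ m ih =>
    intro G _ _ A _ hm hd
    have hAs : Group.IsSolvable A := isSolvable_of_isCyclic
    rcases Nat.lt_or_ge 4 A.index with h4 | h4
    swap
    · exact isSolvable_of_index_le_four A h4
    by_cases hA : IsCoatom A
    · by_cases hco : (Nat.card A).Coprime A.index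
      · have hsq : Squarefree A.index := by
          interval_cases A.index <;> decide +kernel
        have := IsZGroup.of_cyclic_coprime_squarefree_index A hsq hco
        exact isSolvable_of_isZGroup
      · obtain ⟨r, hr, hra, hrd⟩ := Nat.Prime.not_coprime_iff_dvd.1 hco
        obtain ⟨R, hRn, hR, hRA⟩ := exists_normal_le_of_isCoatom A hA hr hra hrd
        rw [Group.isSolvable_iff_subgroup_quotient R]
        have : IsCyclic R := Subgroup.isCyclic_of_le hRA
        refine ⟨isSolvable_of_isCyclic, ?_⟩
        have : IsCyclic (A.map (QuotientGroup.mk' R)) :=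
          isCyclic_of_surjective ((QuotientGroup.mk' R).subgroupMap A)
            ((QuotientGroup.mk' R).subgroupMap_surjective A)
        refine ih (A.map (QuotientGroup.mk' R)) ?_ ?_
        · have h1 : 1 < Nat.card R := by
            rwa [← Subgroup.one_lt_card_iff_ne_bot] at hR
          have h2 := R.card_mul_index
          have h3 : 0 < R.index := Nat.pos_of_ne_zero R.index_ne_zero_of_finite
          change R.index ≤ m
          nlinarith
        · rwa [Subgroup.index_map_eq _ (QuotientGroup.mk'_surjective R) (by simpa using hRA)]
    · have htop : A ≠ ⊤ := by rintro rfl; simp at h4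
      obtain ⟨M, hAM, hM⟩ : ∃ M, A < M ∧ M ≠ ⊤ := by
        by_contra! h
        exact hA ⟨htop, h⟩
      have hmul := Subgroup.relIndex_mul_index hAM.le
      have h1 : M.index ≠ 1 := by rwa [Ne, Subgroup.index_eq_one]
      have h2 : A.relIndex M ≠ 1 := by
        rw [Ne, Subgroup.relIndex_eq_one]; exact hAM.not_ge
      have h3 : M.index ≠ 0 := M.index_ne_zero_of_finite
      have h5 : A.relIndex M ≠ 0 := by
        intro h; rw [h] at hmul; omega
      have h6 : M.index ≤ 3 := by
        by_contra! h
        have : 2 ≤ A.relIndex M := by omega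
        nlinarith
      have h7 : A.relIndex M ≤ 3 := by
        by_contra! h
        have : 2 ≤ M.index := by omega
        nlinarith
      have : Group.IsSolvable (A.subgroupOf M) :=
        Group.isSolvable_of_isSolvable_injective
          (f := (Subgroup.subgroupOfEquivOfLe hAM.le).toMonoidHom)
          (Subgroup.subgroupOfEquivOfLe hAM.le).injective
      have : Group.IsSolvable M := isSolvable_of_index_le_four (A.subgroupOf M) (h7.trans (by simp))
      exact isSolvable_of_index_le_four M (by omega)

theorem exists_mk_eq_pow_orderOf_eq_one {G : Type*} [Group G] [Finite G] (P : Subgroup G)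
    [P.Normal] (hco : (Nat.card P).Coprime P.index) (c : G ⧸ P) :
    ∃ y : G, (y : G ⧸ P) = c ∧ y ^ orderOf c = 1 := by
  obtain ⟨y, rfl⟩ := QuotientGroup.mk_surjective c
  set m := orderOf (y : G ⧸ P) with hm
  have hmc : m.Coprime (Nat.card P) := by
    refine (Nat.Coprime.coprime_dvd_right ?_ hco).symm
    exact orderOf_dvd_natCard (y : G ⧸ P)
  obtain ⟨e, he1, he0⟩ := Nat.chineseRemainder hmc 1 0
  refine ⟨y ^ e, ?_, ?_⟩
  · rw [QuotientGroup.mk_pow]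
    conv_rhs => rw [← pow_one (y : G ⧸ P)]
    exact pow_eq_pow_iff_modEq.2 he1
  · have hy : y ^ m ∈ P := by
      rw [← QuotientGroup.eq_one_iff, QuotientGroup.mk_pow, hm, pow_orderOf_eq_one]
    obtain ⟨f, rfl⟩ := (Nat.modEq_zero_iff_dvd).1 he0
    rw [← pow_mul, mul_comm, pow_mul, pow_mul]
    have : (⟨y ^ m, hy⟩ : P) ^ Nat.card P = 1 := pow_card_eq_one'
    rw [show (y ^ m) ^ Nat.card P = 1 from congrArg Subtype.val this, one_pow]

theorem exists_mul_pow_eq {G : Type*} [Group G] (P : Subgroup G) [P.Normal] [IsMulCommutative P]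
    (y : G) {u : G} (hu : u ∈ P) {t : ℕ} (ht : u ^ t = 1) (j : ℕ) :
    ∃ w ∈ P, w ^ t = 1 ∧ (y * u) ^ j = w * y ^ j := by
  induction j with
  | zero => exact ⟨1, P.one_mem, by simp⟩
  | succ j ih =>
    obtain ⟨w, hw, hwt, h⟩ := ih
    have hv : y ^ (j + 1) * u * (y ^ (j + 1))⁻¹ ∈ P := Subgroup.Normal.conj_mem ‹_› u hu _
    refine ⟨w * (y ^ (j + 1) * u * (y ^ (j + 1))⁻¹), P.mul_mem hw hv, ?_, ?_⟩
    · have hc : Commute w (y ^ (j + 1) * u * (y ^ (j + 1))⁻¹) :=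
        congrArg Subtype.val (IsMulCommutative.is_comm.comm (⟨w, hw⟩ : P) ⟨_, hv⟩)
      rw [hc.mul_pow, hwt, conj_pow, ht]
      simp
    · rw [pow_succ, h]
      group

theorem orderOf_mul_le {G : Type*} [Group G] [Finite G] (P : Subgroup G) [P.Normal]
    [IsMulCommutative P] {y : G} {m : ℕ} (hm : 0 < m) (hy : y ^ m = 1) (u : P) :
    orderOf (y * u) ≤ m * orderOf u := by
  obtain ⟨w, -, hwt, h⟩ := exists_mul_pow_eq P y u.2
    (t := orderOf u) (by rw [← Subgroup.orderOf_coe, pow_orderOf_eq_one]) m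
  refine orderOf_le_of_pow_eq_one (Nat.mul_pos hm (orderOf_pos u)) ?_
  rw [pow_mul, h, hy, mul_one, hwt]

theorem sum_orderOf_le_mul_quotient {G : Type*} [Group G] [Fintype G] (P : Subgroup G)
    [P.Normal] [IsMulCommutative P] [Fintype P] [Fintype (G ⧸ P)]
    (hco : (Nat.card P).Coprime P.index) :
    ∑ g : G, orderOf g ≤ (∑ u : P, orderOf u) * ∑ c : G ⧸ P, orderOf c := by
  choose s hs hs1 using exists_mk_eq_pow_orderOf_eq_one P hco
  have hb : Function.Bijective fun z : (G ⧸ P) × P ↦ s z.1 * z.2 := by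
    constructor
    · rintro ⟨c, u⟩ ⟨c', u'⟩ h
      have hc : c = c' := by
        have := congrArg (QuotientGroup.mk : G → G ⧸ P) h
        simpa [QuotientGroup.mk_mul_of_mem, hs] using this
      subst hc
      simpa using h
    · intro g
      refine ⟨(g, ⟨(s g)⁻¹ * g, ?_⟩), by simp⟩
      rw [← QuotientGroup.eq, hs]
  rw [← hb.sum_comp, Fintype.sum_prod_type, mul_comm, Finset.sum_mul]
  refine Finset.sum_le_sum fun c _ ↦ ?_
  rw [Finset.mul_sum]
  exact Finset.sum_le_sum fun u _ ↦ orderOf_mul_le P (orderOf_pos c) (hs1 c) u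

theorem sum_orderOf_le_of_card_eq_prime_pow {C : Type*} [Group C] [Fintype C] [IsCyclic C] {p k : ℕ}
    (hp : p.Prime) (hC : Fintype.card C = p ^ (k + 1)) :
    ∑ g : C, orderOf g ≤ p ^ (k + 1) * (p ^ (k + 1)).totient + p ^ k * p ^ k := by
  classical
  rw [← Finset.sum_filter_add_sum_filter_not _ fun g : C ↦ orderOf g = p ^ (k + 1)]
  have h1 := IsCyclic.card_orderOf_eq_totient (α := C) (d := p ^ (k + 1)) hC.symm.dvd
  have h2 := Finset.card_filter_add_card_filter_not (s := (Finset.univ : Finset C))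
    (fun g : C ↦ orderOf g = p ^ (k + 1))
  rw [h1, Finset.card_univ, hC, Nat.totient_prime_pow_succ hp] at h2
  gcongr
  · rw [← h1, mul_comm, ← smul_eq_mul]
    exact Finset.sum_le_card_nsmul _ _ _ fun g hg ↦ (Finset.mem_filter.1 hg).2.le
  · have h3 : (Finset.univ.filter fun g : C ↦ ¬orderOf g = p ^ (k + 1)).card = p ^ k := by
      obtain ⟨q, rfl⟩ : ∃ q, p = q + 1 := ⟨p - 1, by have := hp.pos; omega⟩
      rw [pow_succ, Nat.add_sub_cancel, mul_add, mul_one] at h2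
      exact Nat.add_left_cancel h2
    refine (Finset.sum_le_card_nsmul _ _ (p ^ k) fun g hg ↦ ?_).trans (by rw [h3, smul_eq_mul])
    obtain ⟨i, hi, hgi⟩ := (Nat.dvd_prime_pow hp).1 (hC ▸ orderOf_dvd_card (x := g))
    have hne : i ≠ k + 1 := by rintro rfl; exact (Finset.mem_filter.1 hg).2 hgi
    rw [hgi]
    exact Nat.pow_le_pow_right hp.pos (by omega)

theorem exists_sum_orderOf_le {G : Type*} [Group G] [Fintype G] :
    ∃ x : G, ∑ g : G, orderOf g ≤ Fintype.card G * orderOf x := by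
  obtain ⟨x, -, hx⟩ := Finset.exists_max_image (Finset.univ : Finset G) orderOf ⟨1, by simp⟩
  refine ⟨x, ?_⟩
  rw [← smul_eq_mul]
  exact Finset.sum_le_card_nsmul _ _ _ hx

theorem le_prod_one_sub_inv_primes (m : ℕ) (hm : 8 ≤ m) :
    (64 / 35 : ℚ) / m ≤ ∏ p ∈ (Finset.range (m + 1)).filter Nat.Prime, (1 - (p : ℚ)⁻¹) := by
  induction m, hm using Nat.le_induction with
  | base =>
    rw [show (Finset.range (8 + 1)).filter Nat.Prime = {2, 3, 5, 7} by decide +kernel]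
    norm_num
  | succ m hm ih =>
    have hm0 : (0 : ℚ) < m := by exact_mod_cast (by omega : 0 < m)
    rw [Finset.range_add_one, Finset.filter_insert]
    split_ifs with h
    · rw [Finset.prod_insert (by simp)]
      have h1 : (1 - ((m + 1 : ℕ) : ℚ)⁻¹) = m / (m + 1) := by
        push_cast; field_simp; ring
      rw [h1]
      calc (64 / 35 : ℚ) / (m + 1 : ℕ) = m / (m + 1) * (64 / 35 / m) := by
            push_cast; field_simp
        _ ≤ _ := by gcongr
    · refine le_trans ?_ ih
      gcongr
      omega

/-- A lower bound for `φ(n)` in terms of a bound for the prime divisors of `n`. -/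
theorem le_totient_of_primeFactors_le {n m : ℕ} (hm : 8 ≤ m)
    (h : ∀ p : ℕ, p.Prime → p ∣ n → p ≤ m) : n * ((64 / 35 : ℚ) / m) ≤ n.totient := by
  rw [Nat.totient_eq_mul_prod_factors]
  refine mul_le_mul_of_nonneg_left ((le_prod_one_sub_inv_primes m hm).trans ?_) (by positivity)
  have hp1 : ∀ p ∈ (Finset.range (m + 1)).filter Nat.Prime, (p : ℚ)⁻¹ ≤ 1 := fun p hp ↦
    inv_le_one_of_one_le₀ (by exact_mod_cast (Finset.mem_filter.1 hp).2.one_le)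
  refine Finset.prod_le_prod_of_subset_of_le_one (fun p hp ↦ ?_) (fun p hp ↦ ?_) fun p _ _ ↦ ?_
  · rw [Nat.mem_primeFactors] at hp
    simpa [hp.1, Nat.lt_succ_iff] using h p hp.1 hp.2.1
  · linarith [hp1 p hp]
  · linarith [inv_nonneg.2 (Nat.cast_nonneg (α := ℚ) p)]

/-- A large sum of element orders forces a cyclic subgroup of small index. -/
theorem exists_isCyclic_index_mul_le {G : Type*} [Group G] [Fintype G] {c : ℚ} (hc : 0 ≤ c) {m : ℕ}
    (hm : 8 ≤ m) (hp : ∀ p : ℕ, p.Prime → p ∣ Fintype.card G → p ≤ m)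
    (h : c * (Fintype.card G * (Fintype.card G).totient) ≤ ∑ g : G, (orderOf g : ℚ)) :
    ∃ A : Subgroup G, IsCyclic A ∧ A.index * c * (64 / 35) ≤ (m : ℚ) := by
  obtain ⟨x, hx⟩ := exists_sum_orderOf_le (G := G)
  refine ⟨Subgroup.zpowers x, inferInstance, ?_⟩
  have hmul : orderOf x * (Subgroup.zpowers x).index = Fintype.card G := by
    rw [← Nat.card_zpowers, Subgroup.card_mul_index, Nat.card_eq_fintype_card]
  have hφ := le_totient_of_primeFactors_le hm hp
  have hx' : ∑ g : G, (orderOf g : ℚ) ≤ Fintype.card G * orderOf x := by exact_mod_cast hx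
  have hn : (0 : ℚ) < Fintype.card G := by exact_mod_cast Fintype.card_pos
  have hm0 : (0 : ℚ) < m := by exact_mod_cast (by omega : 0 < m)
  have ho : (0 : ℚ) < orderOf x := by exact_mod_cast orderOf_pos x
  have h1 : c * (Fintype.card G : ℚ) * (64 / 35 / m) ≤ orderOf x := by
    have h2 := mul_le_mul_of_nonneg_left hφ (mul_nonneg hc hn.le)
    refine le_of_mul_le_mul_left ?_ hn
    calc (Fintype.card G : ℚ) * (c * (Fintype.card G : ℚ) * (64 / 35 / m))
        = c * Fintype.card G * (Fintype.card G * (64 / 35 / m)) := by ring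
      _ ≤ c * Fintype.card G * (Fintype.card G).totient := h2
      _ = c * (Fintype.card G * (Fintype.card G).totient) := by ring
      _ ≤ _ := h.trans hx'
  rw [← hmul] at h1
  refine le_of_mul_le_mul_left ?_ ho
  calc (orderOf x : ℚ) * ((Subgroup.zpowers x).index * c * (64 / 35))
      = c * (orderOf x * (Subgroup.zpowers x).index : ℕ) * (64 / 35 / m) * m := by
        push_cast; field_simp
    _ ≤ orderOf x * m := by gcongr

/-- If a cyclic subgroup has index less than a prime `p`, the Sylow `p`-subgroup is normal. -/
theorem exists_normal_sylow_of_index_lt {G : Type*} [Group G] [Finite G] (A : Subgroup G)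
    [IsCyclic A] {p : ℕ} [hp : Fact p.Prime] (hA : A.index < p) :
    ∃ P : Sylow p G, (P : Subgroup G).Normal ∧ IsCyclic P := by
  have hpA : ¬ p ∣ A.index := fun h ↦
    hA.not_ge (Nat.le_of_dvd (Nat.pos_of_ne_zero A.index_ne_zero_of_finite) h)
  have hdvd : p ^ (Nat.card G).factorization p ∣ Nat.card A := by
    refine Nat.Coprime.dvd_of_dvd_mul_right (n := A.index)
      (((Nat.Prime.coprime_iff_not_dvd hp.out).2 hpA).pow_left _) ?_
    rw [A.card_mul_index]
    exact Nat.ordProj_dvd _ _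
  obtain ⟨K, hK⟩ := Sylow.exists_subgroup_card_pow_prime p hdvd
  have hKA : K.map A.subtype ≤ A := Subgroup.map_subtype_le K
  let P : Sylow p G := Sylow.ofCard (K.map A.subtype) (by
    rw [Subgroup.card_map_of_injective A.subtype_injective, hK])
  refine ⟨P, ?_, Subgroup.isCyclic_of_le hKA⟩
  have hle : A ≤ Subgroup.normalizer ((P : Subgroup G) : Set G) := le_normalizer_of_le_isCyclic hKA
  have hlt : Nat.card (Sylow p G) < p := by
    rw [P.card_eq_index_normalizer]
    exact (Nat.le_of_dvd (Nat.pos_of_ne_zero A.index_ne_zero_of_finite)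
      (Subgroup.index_dvd_of_le hle)).trans_lt hA
  have h1 : Nat.card (Sylow p G) = 1 :=
    Nat.ModEq.eq_of_lt_of_lt (card_sylow_modEq_one p G) hlt hp.out.one_lt
  rw [P.card_eq_index_normalizer, Subgroup.index_eq_one] at h1
  exact Subgroup.normalizer_eq_top_iff.1 h1

theorem totient_bound_of_mul_prime_pow {p k n' : ℕ} (hp : p.Prime) {S S₁ S₂ c c' : ℚ}
    (hco : (p ^ (k + 1)).Coprime n') (hS₂ : 0 ≤ S₂) (h : S ≤ S₁ * S₂)
    (hS₁ : S₁ ≤ p ^ (k + 1) * (p ^ (k + 1)).totient + p ^ k * p ^ k)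
    (hc : c' * (p * (p - 1) + 1) ≤ c * (p * (p - 1)))
    (hS : c * ((p ^ (k + 1) * n' : ℕ) * (p ^ (k + 1) * n').totient) ≤ S) :
    c' * (n' * n'.totient) ≤ S₂ := by
  rw [Nat.totient_mul hco] at hS
  rw [Nat.totient_prime_pow_succ hp] at hS hS₁
  have hp1 : (1 : ℚ) ≤ p := by exact_mod_cast hp.one_le
  push_cast [hp.one_le] at hS hS₁
  have hq : (0 : ℚ) < (p : ℚ) ^ k * p ^ k := by positivity
  have hr : (0 : ℚ) < p * (p - 1) + 1 := by nlinarith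
  have hX : (0 : ℚ) ≤ n' * n'.totient := by positivity
  have h1 : (p ^ k * p ^ k : ℚ) * (c * (p * (p - 1)) * (n' * n'.totient)) ≤
      (p ^ k * p ^ k : ℚ) * ((p * (p - 1) + 1) * S₂) := by
    calc _ = c * (p ^ (k + 1) * n' * (p ^ k * (p - 1) * n'.totient) : ℚ) := by ring
      _ ≤ S₁ * S₂ := hS.trans h
      _ ≤ (p ^ (k + 1) * (p ^ k * (p - 1)) + p ^ k * p ^ k) * S₂ := by gcongr
      _ = _ := by ring
  have h2 := le_of_mul_le_mul_left h1 hq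
  have h3 := mul_le_mul_of_nonneg_right hc hX
  refine le_of_mul_le_mul_left (h2.trans' (h3.trans' ?_)) hr
  exact le_of_eq (by ring)

theorem totient_ratio_sub_two_le {p : ℚ} (hp : 3 ≤ p) :
    3 / 5 * (1 - 1 / (2 * (p - 2))) * (p * (p - 1) + 1) ≤
      3 / 5 * (1 - 1 / (2 * p)) * (p * (p - 1)) := by
  have h2 : 0 < p - 2 := by linarith
  have h0 : 0 < p := by linarith
  rw [← sub_nonneg]
  have : 3 / 5 * (1 - 1 / (2 * p)) * (p * (p - 1)) -
      3 / 5 * (1 - 1 / (2 * (p - 2))) * (p * (p - 1) + 1) = 9 / (10 * (p - 2)) := by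
    field_simp
    ring
  rw [this]
  positivity

theorem isSolvable_of_le_sum_orderOf (m : ℕ) : 7 ≤ m → ∀ {G : Type*} [Group G] [Fintype G],
    (∀ p : ℕ, p.Prime → p ∣ Fintype.card G → p ≤ m) →
    3 / 5 * (1 - 1 / (2 * (m : ℚ))) * (Fintype.card G * (Fintype.card G).totient) ≤
      ∑ g : G, (orderOf g : ℚ) → Group.IsSolvable G := by
  induction m using Nat.strong_induction_on with
  | _ m ih =>
  intro hm G _ _ hG h
  have hmq : (7 : ℚ) ≤ m := by exact_mod_cast hm
  have hanti : ∀ a b : ℚ, 7 ≤ a → a ≤ b →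
      3 / 5 * (1 - 1 / (2 * a)) ≤ 3 / 5 * (1 - 1 / (2 * b)) := fun a b ha hab ↦ by
    gcongr
  rcases Nat.lt_or_ge m 11 with hm11 | hm11
  · have h8 : ∀ p : ℕ, p.Prime → p ∣ Fintype.card G → p ≤ 8 := fun p hp hpG ↦ by
      have := hG p hp hpG
      by_contra!
      have : p = 9 ∨ p = 10 := by omega
      rcases this with rfl | rfl <;> revert hp <;> decide
    obtain ⟨A, hA, hi⟩ := exists_isCyclic_index_mul_le (c := 3 / 5 * (1 - 1 / (2 * 7)))
      (by norm_num) le_rfl h8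
      ((mul_le_mul_of_nonneg_right (hanti 7 m le_rfl hmq) (by positivity)).trans h)
    refine isSolvable_of_cyclic_index_le_seven _ A le_rfl ?_
    by_contra! hlt
    have : (8 : ℚ) ≤ A.index := by exact_mod_cast hlt
    norm_num at hi
    linarith
  by_cases hmG : m.Prime ∧ m ∣ Fintype.card G
  · obtain ⟨hp, hdvd⟩ := hmG
    have := Fact.mk hp
    have hm11q : (11 : ℚ) ≤ m := by exact_mod_cast hm11
    have h11 := (mul_le_mul_of_nonneg_right (hanti 11 m (by norm_num) hm11q)
      (by positivity)).trans h
    obtain ⟨A, hA, hi⟩ := exists_isCyclic_index_mul_le (c := 3 / 5 * (1 - 1 / (2 * 11)))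
      (by norm_num) (by omega) hG h11
    have hlt : A.index < m := by
      by_contra! hle
      have : (m : ℚ) ≤ A.index := by exact_mod_cast hle
      norm_num at hi
      linarith
    obtain ⟨P, hPn, hPc⟩ := exists_normal_sylow_of_index_lt A hlt
    obtain ⟨k, hk⟩ : ∃ k, Nat.card P = m ^ (k + 1) := by
      obtain ⟨j, hj⟩ := P.2.exists_card_eq
      cases j with
      | zero =>
        have := P.dvd_card_of_dvd_card (by rwa [Nat.card_eq_fintype_card])
        rw [hj, pow_zero] at this
        exact absurd this hp.not_dvd_one
      | succ k => exact ⟨k, hj⟩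
    have hk' : Nat.card (P : Subgroup G) = m ^ (k + 1) := hk
    let : Fintype (P : Subgroup G) := Fintype.ofFinite _
    let : Fintype (G ⧸ (P : Subgroup G)) := Fintype.ofFinite _
    have hq : Fintype.card (G ⧸ (P : Subgroup G)) = (P : Subgroup G).index := by
      rw [← Nat.card_eq_fintype_card]; rfl
    have hcard : Fintype.card G = m ^ (k + 1) * (P : Subgroup G).index := by
      rw [← Nat.card_eq_fintype_card, ← (P : Subgroup G).card_mul_index, hk']
    have hsum := sum_orderOf_le_mul_quotient (P : Subgroup G) P.card_coprime_index
    have hP := sum_orderOf_le_of_card_eq_prime_pow (C := (P : Subgroup G)) hp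
      (by rw [← Nat.card_eq_fintype_card, hk'])
    have hco : (m ^ (k + 1)).Coprime (P : Subgroup G).index := hk' ▸ P.card_coprime_index
    have hm2 : ((m - 2 : ℕ) : ℚ) = m - 2 := by
      rw [Nat.cast_sub (by omega)]; rfl
    rw [hcard] at h
    have key := totient_bound_of_mul_prime_pow hp hco
      (S₂ := ((∑ c : G ⧸ (P : Subgroup G), orderOf c : ℕ) : ℚ)) (by positivity)
      (S₁ := ((∑ u : (P : Subgroup G), orderOf u : ℕ) : ℚ))
      (by exact_mod_cast hsum) (by exact_mod_cast hP)
      (totient_ratio_sub_two_le (p := (m : ℚ)) (by linarith)) h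
    rw [Group.isSolvable_iff_subgroup_quotient (P : Subgroup G)]
    refine ⟨isSolvable_of_isCyclic, ih (m - 2) (by omega) (by omega) (fun r hr hrd ↦ ?_) ?_⟩
    · rw [hq] at hrd
      have h1 := hG r hr (hcard ▸ Dvd.dvd.mul_left hrd _)
      have h2 : r ≠ m := by
        rintro rfl
        exact P.not_dvd_index hrd
      have h3 : r ≠ m - 1 := by
        rintro rfl
        rcases hp.eq_two_or_odd' with h | h
        · omega
        · rcases hr.eq_two_or_odd' with h' | h'
          · omega
          · rcases h with ⟨a, ha⟩
            rcases h' with ⟨b, hb⟩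
            omega
      omega
    · rw [hq, hm2]
      exact_mod_cast key
  · refine ih (m - 1) (by omega) (by omega) (fun r hr hrd ↦ ?_) (h.trans' ?_)
    · have h1 := hG r hr hrd
      have h2 : r ≠ m := by
        rintro rfl
        exact hmG ⟨hr, hrd⟩
      omega
    · exact mul_le_mul_of_nonneg_right (hanti _ _ (by exact_mod_cast (by omega : 7 ≤ m - 1))
        (by exact_mod_cast Nat.sub_le m 1)) (by positivity)

/-- In a non-cyclic group, element orders are at most `n / q` for a lower bound `q` of the prime
divisors of the order `n`. -/
theorem orderOf_mul_le_card_of_not_isCyclic {G : Type*} [Group G] [Fintype G] {q : ℕ}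
    (hmin : ∀ r : ℕ, r.Prime → r ∣ Fintype.card G → q ≤ r) (hG : ¬ IsCyclic G) (g : G) :
    orderOf g * q ≤ Fintype.card G := by
  obtain ⟨t, ht⟩ := orderOf_dvd_card (x := g)
  have ht1 : t ≠ 1 := by
    rintro rfl
    exact hG (isCyclic_of_orderOf_eq_card g (by rw [Nat.card_eq_fintype_card, ht, mul_one]))
  have ht0 : 0 < t := Nat.pos_of_ne_zero (by
    rintro rfl
    exact Fintype.card_ne_zero ht)
  rw [ht]
  gcongr
  exact (hmin _ (Nat.minFac_prime ht1) (ht ▸ (Nat.minFac_dvd t).mul_left _)).trans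
    (Nat.minFac_le ht0)

theorem solvable_of_psi_ge_totient
    (G : Type*) [Group G] [Fintype G] (n : ℕ) (hn : Fintype.card G = n)
    (q : ℕ) (hq : q.Prime) (hqn : q ∣ n)
    (hmin : ∀ r : ℕ, r.Prime → r ∣ n → q ≤ r)
    (k : ℕ) (hk : 1 ≤ k)
    (h : (psi G k : ℚ) ≥ (3 * (n : ℚ) ^ k / (5 * (q : ℚ) ^ (k - 1))) * (Nat.totient n : ℚ)) :
    IsSolvable G := by
  subst hn
  by_cases hG : IsCyclic G
  · exact isSolvable_of_isCyclic
  obtain ⟨j, rfl⟩ : ∃ j, k = j + 1 := ⟨k - 1, by omega⟩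
  have hq0 : (0 : ℚ) < q := by exact_mod_cast hq.pos
  have hn0 : (0 : ℚ) < Fintype.card G := by exact_mod_cast Fintype.card_pos
  have ho : ∀ g : G, (orderOf g : ℚ) ≤ Fintype.card G / q := fun g ↦ by
    rw [le_div_iff₀ hq0]
    exact_mod_cast orderOf_mul_le_card_of_not_isCyclic hmin hG g
  have hψ : (psi G (j + 1) : ℚ) ≤ (Fintype.card G / q : ℚ) ^ j * ∑ g : G, (orderOf g : ℚ) := by
    rw [psi, Finset.mul_sum]
    push_cast
    refine Finset.sum_le_sum fun g _ ↦ ?_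
    rw [pow_succ]
    gcongr
    exact ho g
  have hsum : 3 / 5 * ((Fintype.card G : ℚ) * (Fintype.card G).totient) ≤
      ∑ g : G, (orderOf g : ℚ) := by
    refine le_of_mul_le_mul_left ((h.le.trans hψ).trans' ?_)
      (by positivity : (0 : ℚ) < (Fintype.card G / q : ℚ) ^ j)
    rw [Nat.add_sub_cancel, div_pow, pow_succ]
    exact le_of_eq (by field_simp)
  refine isSolvable_of_le_sum_orderOf (max 7 (Fintype.card G)) (le_max_left _ _)
    (fun p _ hpd ↦ (Nat.le_of_dvd Fintype.card_pos hpd).trans (le_max_right _ _)) (hsum.trans' ?_)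
  refine mul_le_mul_of_nonneg_right ?_ (by positivity)
  have : (0 : ℚ) ≤ 1 / (2 * (max 7 (Fintype.card G) : ℕ)) := by positivity
  linarith
end
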